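/- For all integers k ≥ 1, m ≥ 1 and all x ≥ y in ℝ, lim_{n→∞} P( M̃_n^{(k)} ≤ u_n(x), M_n^{(m)} ≤ u_n(y) ) = ∑_{t=0}^{m−1} ∑_{i=0}^{m−t−1} ∑_{j=0}^{min{i, k−1}} E ∫_{−∞}^{+∞} [ ((1−λ) g(y,z))^t / t! · exp(−g(y,z)) · (λ g(x,z))^j / j! · (λ (g(y,z) − g(x,z)))^{i−j} / (i−j)! ] dΦ(z). -/

import Mathlib

open MeasureTheory ProbabilityTheory Filter Real
open scoped Classical NNReal ENNReal

/-- The normalizing levels `u_n(x) = x/a_n + b_n` with `a_n = (2 ln n)^{1/2}` and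
`b_n = a_n - (ln ln n + ln (4π))/(2 a_n)`. -/
noncomputable def un (n : ℕ) (x : ℝ) : ℝ :=
  x / Real.sqrt (2 * Real.log n) +
    (Real.sqrt (2 * Real.log n) -
      (Real.log (Real.log n) + Real.log (4 * Real.pi)) / (2 * Real.sqrt (2 * Real.log n)))

/-- `g(x,z) = exp(-x - γ + √(2γ) z)`. -/
noncomputable def g (γ x z : ℝ) : ℝ := Real.exp (-x - γ + Real.sqrt (2 * γ) * z)

/-- The standard Gaussian measure on `κ → ℝ`. -/
noncomputable def stdG (κ : Type*) [Fintype κ] : Measure (κ → ℝ) :=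
  Measure.pi fun _ => gaussianReal 0 1

instance stdG.isProbabilityMeasure (κ : Type*) [Fintype κ] : IsProbabilityMeasure (stdG κ) := by
  unfold stdG; infer_instance

lemma hasDerivAt_gaussianPDFReal (x : ℝ) :
    HasDerivAt (gaussianPDFReal 0 1) (-x * gaussianPDFReal 0 1 x) x := by
  have h : gaussianPDFReal 0 1 = fun x : ℝ => (√(2 * π))⁻¹ * rexp (-x ^ 2 / 2) := by
    ext x; simp [gaussianPDFReal_def]
  rw [h]
  have h1 : HasDerivAt (fun x : ℝ => -x ^ 2 / 2) (-x) x := by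
    refine (((hasDerivAt_pow 2 x).fun_neg).div_const 2).congr_deriv ?_
    norm_num; ring
  refine (h1.exp.const_mul ((√(2 * π))⁻¹)).congr_deriv ?_
  ring

/-- Stein's identity for the standard Gaussian law on the line. -/
lemma integral_id_mul_gaussianReal {ψ ψ' : ℝ → ℝ} {C : ℝ}
    (hd : ∀ x, HasDerivAt ψ (ψ' x) x) (hm : Measurable ψ')
    (hb : ∀ x, |ψ x| ≤ C) (hb' : ∀ x, |ψ' x| ≤ C) :
    ∫ x, x * ψ x ∂(gaussianReal 0 1) = ∫ x, ψ' x ∂(gaussianReal 0 1) := by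
  have hψ : Continuous ψ := continuous_iff_continuousAt.2 fun x => (hd x).continuousAt
  have hid : Integrable (fun x : ℝ => gaussianPDFReal 0 1 x * x) volume := by
    have h : Integrable (fun x : ℝ => x) (gaussianReal 0 1) :=
      (memLp_id_gaussianReal 1).integrable le_rfl
    rw [gaussianReal_of_var_ne_zero _ one_ne_zero,
      integrable_withDensity_iff_integrable_smul' (measurable_gaussianPDF _ _)
        (ae_of_all _ fun x => gaussianPDF_lt_top)] at h
    simpa [toReal_gaussianPDF] using h
  have hp : Integrable (gaussianPDFReal 0 1) volume := integrable_gaussianPDFReal 0 1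
  have key := integral_mul_deriv_eq_deriv_mul_of_integrable (u := ψ) (v := gaussianPDFReal 0 1)
    (u' := ψ') (v' := fun x => -x * gaussianPDFReal 0 1 x) (fun x _ => hd x)
    (fun x _ => hasDerivAt_gaussianPDFReal x) ?_ ?_ ?_
  · rw [integral_gaussianReal_eq_integral_smul one_ne_zero,
      integral_gaussianReal_eq_integral_smul one_ne_zero]
    simp only [smul_eq_mul]
    have e1 : ∫ x, gaussianPDFReal 0 1 x * (x * ψ x)
        = - ∫ x, ψ x * (-x * gaussianPDFReal 0 1 x) := by
      rw [← integral_neg]; congr 1; ext x; ring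
    rw [e1, key, neg_neg]; congr 1; ext x; ring
  · refine ((hid.neg).bdd_mul (c := C) hψ.aestronglyMeasurable (ae_of_all _ hb)).congr
      (ae_of_all _ fun x => ?_)
    simp only [Pi.mul_apply, Pi.neg_apply]; ring
  · exact hp.bdd_mul (c := C) hm.aestronglyMeasurable (ae_of_all _ hb')
  · exact hp.bdd_mul (c := C) hψ.aestronglyMeasurable (ae_of_all _ hb)

lemma measurable_update_prod {κ : Type*} (a : κ) :
    Measurable (fun p : (κ → ℝ) × ℝ => Function.update p.1 a p.2) := by
  refine measurable_pi_lambda _ fun i => ?_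
  by_cases h : i = a
  · subst h; simpa using measurable_snd
  · simp only [Function.update_of_ne h]; fun_prop

/-- Resampling one coordinate of a standard Gaussian vector preserves its law. -/
lemma map_update_stdG {κ : Type*} [Fintype κ] (a : κ) :
    Measure.map (fun p : (κ → ℝ) × ℝ => Function.update p.1 a p.2)
      ((stdG κ).prod (gaussianReal 0 1)) = stdG κ := by
  have hmeas := measurable_update_prod a
  unfold stdG
  symm
  refine Measure.pi_eq fun s hs => ?_
  rw [Measure.map_apply hmeas (MeasurableSet.univ_pi hs)]
  have : (fun p : (κ → ℝ) × ℝ => Function.update p.1 a p.2) ⁻¹' Set.univ.pi s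
      = (Set.univ.pi (Function.update s a Set.univ)) ×ˢ (s a) := by
    ext ⟨h, g⟩
    simp only [Set.mem_preimage, Set.mem_pi, Set.mem_univ, true_implies, Set.mem_prod]
    constructor
    · intro H
      refine ⟨fun i => ?_, by simpa using H a⟩
      by_cases hi : i = a
      · subst hi; simp
      · simpa [hi] using H i
    · rintro ⟨H, H'⟩ i
      by_cases hi : i = a
      · subst hi; simpa using H'
      · simpa [hi] using H i
  rw [this, Measure.prod_prod, Measure.pi_pi, ← Finset.mul_prod_erase _ _ (Finset.mem_univ a),
    ← Finset.mul_prod_erase (a := a) (f := fun i => (gaussianReal 0 1) (s i)) _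
      (Finset.mem_univ a)]
  simp only [Function.update_self, measure_univ, one_mul]
  rw [mul_comm]
  congr 1
  refine Finset.prod_congr rfl fun i hi => ?_
  rw [Function.update_of_ne (Finset.ne_of_mem_erase hi)]

lemma integrable_coord_stdG {κ : Type*} [Fintype κ] (a : κ) :
    Integrable (fun h : κ → ℝ => h a) (stdG κ) := by
  have h : Integrable (fun x : ℝ => x) (gaussianReal 0 1) :=
    (memLp_id_gaussianReal 1).integrable le_rfl
  exact (measurePreserving_eval (fun _ : κ => gaussianReal 0 1) a).integrable_comp_of_integrable h

/-- Stein's identity for a coordinate of a standard Gaussian vector. -/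
lemma integral_coord_mul_stdG {κ : Type*} [Fintype κ] (a : κ) {ψ ψ' : (κ → ℝ) → ℝ} {C : ℝ}
    (hd : ∀ h x, HasDerivAt (fun x => ψ (Function.update h a x))
      (ψ' (Function.update h a x)) x)
    (hψ : Measurable ψ) (hm : Measurable ψ') (hb : ∀ x, |ψ x| ≤ C) (hb' : ∀ x, |ψ' x| ≤ C) :
    ∫ h, h a * ψ h ∂(stdG κ) = ∫ h, ψ' h ∂(stdG κ) := by
  have hmeas := measurable_update_prod a
  have hu : ∀ h : κ → ℝ, Measurable fun x : ℝ => Function.update h a x := fun h =>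
    hmeas.comp (measurable_prodMk_left)
  have hmp : MeasurePreserving (fun p : (κ → ℝ) × ℝ => Function.update p.1 a p.2)
      ((stdG κ).prod (gaussianReal 0 1)) (stdG κ) := ⟨hmeas, map_update_stdG a⟩
  have i1 : Integrable (fun h : κ → ℝ => h a * ψ h) (stdG κ) :=
    ((integrable_coord_stdG a).bdd_mul (c := C) hψ.aestronglyMeasurable (ae_of_all _ hb)).congr
      (ae_of_all _ fun h => mul_comm _ _)
  have i2 : Integrable ψ' (stdG κ) :=
    Integrable.of_bound hm.aestronglyMeasurable C (ae_of_all _ hb')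
  have e : ∀ {f : (κ → ℝ) → ℝ}, Integrable f (stdG κ) → ∫ h, f h ∂(stdG κ) =
      ∫ h, ∫ x, f (Function.update h a x) ∂(gaussianReal 0 1) ∂(stdG κ) := by
    intro f hf
    have h1 := hmp.integrable_comp_of_integrable hf
    have h2 := integral_map (μ := (stdG κ).prod (gaussianReal 0 1)) hmeas.aemeasurable (f := f)
      (by rw [hmp.map_eq]; exact hf.aestronglyMeasurable)
    rw [hmp.map_eq] at h2
    rw [h2]
    exact integral_prod _ h1
  rw [e i1, e i2]
  congr 1
  ext h
  simp only [Function.update_self]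
  exact integral_id_mul_gaussianReal (ψ := fun x => ψ (Function.update h a x))
    (ψ' := fun x => ψ' (Function.update h a x)) (hd h) (hm.comp (hu h)) (fun x => hb _)
    (fun x => hb' _)

/-- The chain rule along differentiable curves: `F'` is the gradient of `F`. -/
def HasGrad {ι : Type*} [Fintype ι] (F : (ι → ℝ) → ℝ) (F' : ι → (ι → ℝ) → ℝ) : Prop :=
  ∀ (c : ℝ → ι → ℝ) (c' : ι → ℝ) (x : ℝ), (∀ i, HasDerivAt (fun t => c t i) (c' i) x) →
    HasDerivAt (fun t => F (c t)) (∑ i, F' i (c x) * c' i) x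

/-- The rotation `cos θ · A + sin θ · B` applied to a vector. -/
noncomputable def rotMap {ι κ : Type*} [Fintype κ] (A B : ι → κ → ℝ) (θ : ℝ) (h : κ → ℝ) :
    ι → ℝ :=
  fun i => ∑ a, (cos θ * A i a + sin θ * B i a) * h a

lemma measurable_rotMap {ι κ : Type*} [Fintype κ] (A B : ι → κ → ℝ) (θ : ℝ) :
    Measurable (rotMap A B θ) := by
  unfold rotMap; fun_prop

section Interpolation

variable {ι κ : Type*} [Fintype ι] [Fintype κ] {A B : ι → κ → ℝ}
  {F : (ι → ℝ) → ℝ} {F' : ι → (ι → ℝ) → ℝ} {F'' : ι → ι → (ι → ℝ) → ℝ} {C : ℝ}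

lemma integral_coord_mul_comp_rotMap (hF' : ∀ i, HasGrad (F' i) (F'' i))
    (hm' : ∀ i, Measurable (F' i)) (hm'' : ∀ i j, Measurable (F'' i j))
    (hb' : ∀ i v, |F' i v| ≤ C) (hb'' : ∀ i j v, |F'' i j v| ≤ C) (θ : ℝ) (i : ι) (a : κ) :
    ∫ h, h a * F' i (rotMap A B θ h) ∂(stdG κ) =
      ∑ j, (cos θ * A j a + sin θ * B j a) * ∫ h, F'' i j (rotMap A B θ h) ∂(stdG κ) := by
  have hL := measurable_rotMap A B θ
  set K : ℝ := C + ∑ j, C * |cos θ * A j a + sin θ * B j a| with hK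
  have hC : 0 ≤ C := (abs_nonneg _).trans (hb' i 0)
  have hs : 0 ≤ ∑ j, C * |cos θ * A j a + sin θ * B j a| :=
    Finset.sum_nonneg fun j _ => by positivity
  rw [integral_coord_mul_stdG a (ψ := fun h => F' i (rotMap A B θ h))
    (ψ' := fun h => ∑ j, F'' i j (rotMap A B θ h) * (cos θ * A j a + sin θ * B j a)) (C := K)]
  · rw [integral_finsetSum]
    · refine Finset.sum_congr rfl fun j _ => ?_
      rw [integral_mul_const, mul_comm]
    · intro j _
      exact (Integrable.of_bound ((hm'' i j).comp hL).aestronglyMeasurable C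
        (ae_of_all _ fun h => hb'' i j _)).mul_const _
  · intro h x
    refine hF' i (fun x => rotMap A B θ (Function.update h a x)) _ x fun j => ?_
    have : ∀ b ∈ Finset.univ, HasDerivAt
        (fun x => (cos θ * A j b + sin θ * B j b) * Function.update h a x b)
        (if b = a then cos θ * A j a + sin θ * B j a else 0) x := by
      intro b _
      by_cases hb : b = a
      · subst hb
        simpa using (hasDerivAt_id x).const_mul (cos θ * A j b + sin θ * B j b)
      · simpa [hb] using hasDerivAt_const x ((cos θ * A j b + sin θ * B j b) * h b)
    simpa [rotMap] using HasDerivAt.fun_sum this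
  · exact (hm' i).comp hL
  · exact Finset.measurable_sum _ fun j _ => ((hm'' i j).comp hL).mul_const _
  · intro h; exact (hb' i _).trans (by linarith)
  · intro h
    refine (Finset.abs_sum_le_sum_abs _ _).trans ?_
    refine le_trans (Finset.sum_le_sum fun j _ => ?_) (le_add_of_nonneg_left hC)
    rw [abs_mul]
    exact mul_le_mul_of_nonneg_right (hb'' i j _) (abs_nonneg _)

lemma hasDerivAt_integral_rotMap (hF : HasGrad F F') (hF' : ∀ i, HasGrad (F' i) (F'' i))
    (hm : Measurable F)
    (hm' : ∀ i, Measurable (F' i)) (hm'' : ∀ i j, Measurable (F'' i j))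
    (hb : ∀ v, |F v| ≤ C)
    (hb' : ∀ i v, |F' i v| ≤ C) (hb'' : ∀ i j v, |F'' i j v| ≤ C)
    (hAB : ∀ i j, ∑ a, A i a * B j a = 0) (θ : ℝ) :
    HasDerivAt (fun θ => ∫ h, F (rotMap A B θ h) ∂(stdG κ))
      (∑ i, ∑ j, sin θ * cos θ * (∑ a, B i a * B j a - ∑ a, A i a * A j a) *
        ∫ h, F'' i j (rotMap A B θ h) ∂(stdG κ)) θ := by
  have hC : 0 ≤ C := (abs_nonneg _).trans (hb 0)
  have hint : ∀ i a θ, Integrable (fun h => h a * F' i (rotMap A B θ h)) (stdG κ) := by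
    intro i a θ
    exact ((integrable_coord_stdG a).bdd_mul (c := C)
      ((hm' i).comp (measurable_rotMap A B θ)).aestronglyMeasurable
      (ae_of_all _ fun h => hb' i _)).congr (ae_of_all _ fun h => mul_comm _ _)
  set D : ℝ → (κ → ℝ) → ℝ := fun θ h =>
    ∑ i, F' i (rotMap A B θ h) * ∑ a, (-sin θ * A i a + cos θ * B i a) * h a with hD
  have key := hasDerivAt_integral_of_dominated_loc_of_deriv_le (μ := stdG κ) (𝕜 := ℝ)
    (F := fun θ h => F (rotMap A B θ h)) (F' := D) (x₀ := θ) (s := Set.univ)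
    (bound := fun h => ∑ i, C * ∑ a, (|A i a| + |B i a|) * |h a|) univ_mem
    (Eventually.of_forall fun θ => (hm.comp (measurable_rotMap A B θ)).aestronglyMeasurable)
    (Integrable.of_bound (hm.comp (measurable_rotMap A B θ)).aestronglyMeasurable C
        (ae_of_all _ fun h => hb _))
    ?_ ?_ ?_ ?_
  · refine key.2.congr_deriv ?_
    have e1 : ∫ h, D θ h ∂(stdG κ) = ∑ i, ∑ a, (-sin θ * A i a + cos θ * B i a) *
        ∫ h, h a * F' i (rotMap A B θ h) ∂(stdG κ) := by
      simp only [hD, Finset.mul_sum]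
      rw [integral_finsetSum]
      · refine Finset.sum_congr rfl fun i _ => ?_
        rw [integral_finsetSum]
        · refine Finset.sum_congr rfl fun a _ => ?_
          rw [← integral_const_mul]
          congr 1; ext h; ring
        · intro a _
          exact ((hint i a θ).const_mul (-sin θ * A i a + cos θ * B i a)).congr
            (ae_of_all _ fun h => by ring)
      · intro i _
        refine integrable_finsetSum _ fun a _ => ?_
        exact ((hint i a θ).const_mul (-sin θ * A i a + cos θ * B i a)).congr
            (ae_of_all _ fun h => by ring)
    rw [e1]
    refine Finset.sum_congr rfl fun i _ => ?_
    simp_rw [integral_coord_mul_comp_rotMap hF' hm' hm'' hb' hb'' θ i, Finset.mul_sum]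
    rw [Finset.sum_comm]
    refine Finset.sum_congr rfl fun j _ => ?_
    simp_rw [← mul_assoc]
    rw [← Finset.sum_mul]
    congr 1
    have h1 : ∑ a, (-sin θ * A i a + cos θ * B i a) * (cos θ * A j a + sin θ * B j a) =
        sin θ * cos θ * (∑ a, B i a * B j a - ∑ a, A i a * A j a)
        - sin θ ^ 2 * ∑ a, A i a * B j a + cos θ ^ 2 * ∑ a, A j a * B i a := by
      simp only [Finset.mul_sum, mul_sub, ← Finset.sum_sub_distrib, ← Finset.sum_add_distrib]
      refine Finset.sum_congr rfl fun a _ => ?_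
      ring
    rw [h1, hAB, hAB]; ring
  · refine (Finset.measurable_sum _ fun i _ => ?_).aestronglyMeasurable
    exact ((hm' i).comp (measurable_rotMap A B θ)).mul (by fun_prop)
  · refine ae_of_all _ fun h θ _ => ?_
    refine (Finset.abs_sum_le_sum_abs _ _).trans (Finset.sum_le_sum fun i _ => ?_)
    rw [abs_mul]
    refine mul_le_mul (hb' i _) ?_ (abs_nonneg _) hC
    refine (Finset.abs_sum_le_sum_abs _ _).trans (Finset.sum_le_sum fun a _ => ?_)
    rw [abs_mul]
    refine mul_le_mul_of_nonneg_right ((abs_add_le _ _).trans ?_) (abs_nonneg _)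
    rw [abs_mul, abs_mul, abs_neg]
    refine add_le_add ?_ ?_
    · exact mul_le_of_le_one_left (abs_nonneg _) (abs_sin_le_one θ)
    · exact mul_le_of_le_one_left (abs_nonneg _) (abs_cos_le_one θ)
  · exact integrable_finsetSum _ fun i _ => (integrable_finsetSum _ fun a _ =>
      ((integrable_coord_stdG a).abs.const_mul _)).const_mul _
  · refine ae_of_all _ fun h θ _ => ?_
    refine hF (fun θ => rotMap A B θ h) _ θ fun i => ?_
    refine HasDerivAt.fun_sum fun a _ => ?_
    exact (((hasDerivAt_cos θ).mul_const _).add ((hasDerivAt_sin θ).mul_const _)).mul_const _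

/-- Gaussian comparison by interpolation. -/
lemma abs_integral_rotMap_sub_le (hF : HasGrad F F') (hF' : ∀ i, HasGrad (F' i) (F'' i))
    (hm : Measurable F)
    (hm' : ∀ i, Measurable (F' i)) (hm'' : ∀ i j, Measurable (F'' i j))
    (hb : ∀ v, |F v| ≤ C)
    (hb' : ∀ i v, |F' i v| ≤ C) (hb'' : ∀ i j v, |F'' i j v| ≤ C)
    (hAB : ∀ i j, ∑ a, A i a * B j a = 0) (E : ι → ι → ℝ)
    (hE : ∀ θ i j, |∑ a, B i a * B j a - ∑ a, A i a * A j a| *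
      ∫ h, |F'' i j (rotMap A B θ h)| ∂(stdG κ) ≤ E i j) :
    |∫ h, F (fun i => ∑ a, B i a * h a) ∂(stdG κ) - ∫ h, F (fun i => ∑ a, A i a * h a) ∂(stdG κ)|
      ≤ 2 * ∑ i, ∑ j, E i j := by
  have hd := hasDerivAt_integral_rotMap hF hF' hm hm' hm'' hb hb' hb'' hAB
  have hE0 : 0 ≤ ∑ i, ∑ j, E i j := Finset.sum_nonneg fun i _ => Finset.sum_nonneg fun j _ =>
    (mul_nonneg (abs_nonneg _) (integral_nonneg fun h => abs_nonneg _)).trans (hE 0 i j)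
  have := Convex.norm_image_sub_le_of_norm_hasDerivWithin_le (s := Set.univ) (x := 0) (y := π / 2)
    (f := (fun θ => ∫ h, F (rotMap A B θ h) ∂(stdG κ))) (C := ∑ i, ∑ j, E i j)
    (fun θ _ => (hd θ).hasDerivWithinAt) ?_ convex_univ (Set.mem_univ _) (Set.mem_univ _)
  · have hB : ∀ h, rotMap A B (π / 2) h = fun i => ∑ a, B i a * h a := fun h => by
      ext i; simp [rotMap]
    have hA : ∀ h, rotMap A B 0 h = fun i => ∑ a, A i a * h a := fun h => by
      ext i; simp [rotMap]
    simp only [hA, hB, sub_zero, Real.norm_eq_abs] at this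
    refine this.trans ?_
    rw [mul_comm, abs_of_pos pi_div_two_pos]
    exact mul_le_mul_of_nonneg_right (by linarith [pi_le_four]) hE0
  · intro θ _
    refine (Finset.abs_sum_le_sum_abs _ _).trans (Finset.sum_le_sum fun i _ => ?_)
    refine (Finset.abs_sum_le_sum_abs _ _).trans (Finset.sum_le_sum fun j _ => ?_)
    refine le_trans ?_ (hE θ i j)
    rw [abs_mul, abs_mul, abs_mul]
    have h1 : |sin θ| * |cos θ| ≤ 1 :=
      mul_le_one₀ (abs_sin_le_one θ) (abs_nonneg _) (abs_cos_le_one θ)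
    refine mul_le_mul (mul_le_of_le_one_left (abs_nonneg _) h1) (abs_integral_le_integral_abs)
      (abs_nonneg _) (abs_nonneg _)

end Interpolation

section GaussianLaw

lemma measurable_linearForms {ι κ : Type*} [Fintype κ]
    (A : ι → κ → ℝ) :
    Measurable (fun h : κ → ℝ => fun i => ∑ a, A i a * h a) := by fun_prop

variable {ι κ : Type*} [Fintype ι] [Fintype κ]

/-- A linear form of a standard Gaussian vector is Gaussian. -/
lemma map_linearForm_stdG (c : κ → ℝ) :
    Measure.map (fun h : κ → ℝ => ∑ a, c a * h a) (stdG κ) =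
      gaussianReal 0 (∑ a, c a ^ 2).toNNReal := by
  have hm : Measurable (fun h : κ → ℝ => ∑ a, c a * h a) := by fun_prop
  have : IsProbabilityMeasure (Measure.map (fun h : κ → ℝ => ∑ a, c a * h a) (stdG κ)) :=
    Measure.isProbabilityMeasure_map hm.aemeasurable
  apply Measure.ext_of_charFun
  ext t
  rw [charFun_gaussianReal, charFun_apply_real, integral_map hm.aemeasurable (by fun_prop)]
  have h1 : ∀ h : κ → ℝ, Complex.exp (t * ((∑ a, c a * h a : ℝ) : ℂ) * Complex.I) =
      ∏ a, Complex.exp (((t * c a : ℝ) : ℂ) * (h a : ℂ) * Complex.I) := by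
    intro h
    rw [← Complex.exp_sum]
    congr 1
    push_cast
    rw [Finset.mul_sum, Finset.sum_mul]
    refine Finset.sum_congr rfl fun a _ => by ring
  simp_rw [h1]
  unfold stdG
  rw [integral_fintype_prod_eq_prod (𝕜 := ℂ)
    (fun a (x : ℝ) => Complex.exp (((t * c a : ℝ) : ℂ) * (x : ℂ) * Complex.I))]
  simp_rw [← charFun_apply_real, charFun_gaussianReal]
  rw [← Complex.exp_sum]
  congr 1
  rw [Real.coe_toNNReal _ (Finset.sum_nonneg fun a _ => sq_nonneg _)]
  push_cast
  simp only [mul_zero, zero_mul, zero_sub, one_mul, Finset.sum_neg_distrib, Finset.sum_mul,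
    Finset.sum_div]
  congr 1
  refine Finset.sum_congr rfl fun a _ => by ring

/-- The Cramér–Wold device on `ι → ℝ`. -/
lemma measure_pi_ext_of_linearForm {μ ν : Measure (ι → ℝ)} [IsFiniteMeasure μ] [IsFiniteMeasure ν]
    (h : ∀ c : ι → ℝ, μ.map (fun v => ∑ i, c i * v i) = ν.map (fun v => ∑ i, c i * v i)) :
    μ = ν := by
  apply Measure.ext_of_charFunDual
  ext L
  have hL : ⇑L = fun v => ∑ i, L (Pi.single i 1) * v i := by
    ext v
    conv_lhs => rw [pi_eq_sum_univ' v]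
    simp [mul_comm]
  rw [charFunDual_eq_charFun_map_one, charFunDual_eq_charFun_map_one, hL, h]

lemma sum_sq_linearForms (A : ι → κ → ℝ) (c : ι → ℝ) :
    ∑ a, (∑ i, c i * A i a) ^ 2 = ∑ i, ∑ j, c i * c j * ∑ a, A i a * A j a := by
  simp_rw [sq, Finset.sum_mul_sum, Finset.mul_sum]
  rw [Finset.sum_comm]
  refine Finset.sum_congr rfl fun i _ => ?_
  rw [Finset.sum_comm]
  refine Finset.sum_congr rfl fun j _ => Finset.sum_congr rfl fun a _ => by ring

lemma eq_map_stdG {μ : Measure (ι → ℝ)} [IsFiniteMeasure μ] (A : ι → κ → ℝ)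
    (h : ∀ c : ι → ℝ, μ.map (fun v => ∑ i, c i * v i) =
      gaussianReal 0 (∑ i, ∑ j, c i * c j * ∑ a, A i a * A j a).toNNReal) :
    μ = (stdG κ).map (fun h i => ∑ a, A i a * h a) := by
  have hA := measurable_linearForms A
  have := Measure.isProbabilityMeasure_map (μ := stdG κ) hA.aemeasurable
  refine measure_pi_ext_of_linearForm fun c => ?_
  rw [h, ← sum_sq_linearForms, ← map_linearForm_stdG, Measure.map_map (by fun_prop) hA]
  congr 1
  ext h
  simp only [Function.comp, Finset.sum_mul, Finset.mul_sum]
  rw [Finset.sum_comm]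
  refine Finset.sum_congr rfl fun i _ => Finset.sum_congr rfl fun a _ => by ring

/-- A positive semidefinite covariance has a factorisation `S = A Aᵀ`. -/
lemma exists_factor_of_nonneg (S : ι → ι → ℝ) (hs : ∀ i j, S i j = S j i)
    (hp : ∀ c : ι → ℝ, 0 ≤ ∑ i, ∑ j, c i * c j * S i j) :
    ∃ A : ι → ι → ℝ, ∀ i j, ∑ a, A i a * A j a = S i j := by
  have hS : (Matrix.of S).PosSemidef := by
    refine Matrix.PosSemidef.of_dotProduct_mulVec_nonneg ?_ fun c => ?_
    · ext i j; exact hs j i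
    · refine (hp c).trans_eq ?_
      simp only [dotProduct, Matrix.mulVec, Finset.mul_sum, Pi.star_apply, star_trivial,
        Matrix.of_apply]
      refine Finset.sum_congr rfl fun i _ => Finset.sum_congr rfl fun a _ => by ring
  open scoped MatrixOrder in
  obtain ⟨B, hB⟩ := CStarAlgebra.nonneg_iff_eq_star_mul_self.1 hS.nonneg
  refine ⟨fun i a => B a i, fun i j => ?_⟩
  have := congrFun (congrFun hB i) j
  simpa [Matrix.mul_apply, Matrix.star_apply] using this.symm

lemma gaussianPDFReal_le_exp (x : ℝ) : gaussianPDFReal 0 1 x ≤ rexp (-x ^ 2 / 2) := by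
  have h1 : (1 : ℝ) ≤ √(2 * π) := by
    rw [Real.one_le_sqrt]; linarith [pi_gt_three]
  simp only [gaussianPDFReal_def, NNReal.coe_one, mul_one, sub_zero]
  exact mul_le_of_le_one_left (exp_pos _).le (inv_le_one_of_one_le₀ h1)

lemma gaussianReal_Icc_le_of_pdf_le {a b M : ℝ} (hab : a ≤ b)
    (hM : ∀ x ∈ Set.Icc a b, rexp (-x ^ 2 / 2) ≤ M) :
    (gaussianReal 0 1 (Set.Icc a b)).toReal ≤ (b - a) * M := by
  rw [gaussianReal_apply_eq_integral _ one_ne_zero,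
    ENNReal.toReal_ofReal (integral_nonneg fun x => gaussianPDFReal_nonneg _ _ _)]
  have h := norm_setIntegral_le_of_norm_le_const (μ := volume) (s := Set.Icc a b)
    (f := gaussianPDFReal 0 1) (C := M) (by simp) fun x hx => by
      rw [Real.norm_of_nonneg (gaussianPDFReal_nonneg _ _ _)]
      exact (gaussianPDFReal_le_exp x).trans (hM x hx)
  rw [Real.volume_real_Icc_of_le hab, mul_comm] at h
  exact (le_abs_self _).trans h

lemma gaussianReal_Icc_le {a b : ℝ} (ha : 0 ≤ a) (hab : a ≤ b) :
    (gaussianReal 0 1 (Set.Icc a b)).toReal ≤ (b - a) * rexp (-a ^ 2 / 2) := by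
  refine gaussianReal_Icc_le_of_pdf_le hab fun x hx => exp_le_exp.2 ?_
  have : a ^ 2 ≤ x ^ 2 := pow_le_pow_left₀ ha hx.1 2
  linarith

lemma gaussianReal_Icc_le_length {a b : ℝ} (hab : a ≤ b) :
    (gaussianReal 0 1 (Set.Icc a b)).toReal ≤ b - a := by
  have := gaussianReal_Icc_le_of_pdf_le (M := 1) hab fun x _ => by
    rw [exp_le_one_iff]; nlinarith [sq_nonneg x]
  simpa using this

/-- Orthogonal linear forms of a standard Gaussian vector are independent. -/
lemma stdG_orthogonal_forms (p q : κ → ℝ) (h0 : ∑ a, p a * q a = 0) {I J : Set ℝ}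
    (hI : MeasurableSet I) (hJ : MeasurableSet J) :
    stdG κ {h | ∑ a, p a * h a ∈ I ∧ ∑ a, q a * h a ∈ J} =
      gaussianReal 0 1 {x | √(∑ a, p a ^ 2) * x ∈ I} *
        gaussianReal 0 1 {x | √(∑ a, q a ^ 2) * x ∈ J} := by
  set A : Bool → κ → ℝ := fun b => cond b p q with hA
  set D : Bool → Bool → ℝ := fun b b' => if b = b' then cond b √(∑ a, p a ^ 2) √(∑ a, q a ^ 2) else 0
    with hD
  have hmA := measurable_linearForms A
  have hmD := measurable_linearForms D
  have := Measure.isProbabilityMeasure_map (μ := stdG κ) hmA.aemeasurable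
  have key : (stdG κ).map (fun h i => ∑ a, A i a * h a) =
      (stdG Bool).map (fun h i => ∑ a, D i a * h a) := by
    refine eq_map_stdG D fun c => ?_
    rw [Measure.map_map (by fun_prop) hmA]
    have e : (fun v : Bool → ℝ => ∑ i, c i * v i) ∘ (fun h i => ∑ a, A i a * h a) =
        fun h : κ → ℝ => ∑ a, (∑ i, c i * A i a) * h a := by
      ext h
      simp only [Function.comp, Finset.sum_mul, Finset.mul_sum]
      rw [Finset.sum_comm]
      refine Finset.sum_congr rfl fun i _ => Finset.sum_congr rfl fun a _ => by ring
    rw [e, map_linearForm_stdG, sum_sq_linearForms]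
    congr 2
    refine Finset.sum_congr rfl fun i _ => Finset.sum_congr rfl fun j _ => ?_
    congr 1
    have hp : 0 ≤ ∑ a, p a ^ 2 := Finset.sum_nonneg fun a _ => sq_nonneg _
    have hq : 0 ≤ ∑ a, q a ^ 2 := Finset.sum_nonneg fun a _ => sq_nonneg _
    have h0' : ∑ a, q a * p a = 0 := by simpa only [mul_comm] using h0
    cases i <;> cases j <;> simp [hA, hD, h0, h0', ← sq] <;>
      simp [sq_sqrt, hp, hq]
  set T : Set (Bool → ℝ) := {v | v true ∈ I ∧ v false ∈ J} with hT
  have hTm : MeasurableSet T :=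
    (measurable_pi_apply true hI).inter (measurable_pi_apply false hJ)
  have h1 := congrArg (fun m => m T) key
  simp only [Measure.map_apply hmA hTm, Measure.map_apply hmD hTm] at h1
  have h2 : (fun h i => ∑ a, A i a * h a) ⁻¹' T =
      {h : κ → ℝ | ∑ a, p a * h a ∈ I ∧ ∑ a, q a * h a ∈ J} := by
    ext h; simp [hT, hA]
  have h3 : (fun h i => ∑ a, D i a * h a) ⁻¹' T =
      Set.univ.pi fun b : Bool => cond b {x | √(∑ a, p a ^ 2) * x ∈ I}
        {x | √(∑ a, q a ^ 2) * x ∈ J} := by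
    ext h; simp [hT, hD, and_comm]
  rw [h2, h3] at h1
  rw [h1]
  unfold stdG
  rw [Measure.pi_pi]
  simp

/-- Joint probability that two correlated standard Gaussians lie in a short high interval. -/
lemma stdG_pair_window_le (p q : κ → ℝ) (hp : ∑ a, p a ^ 2 = 1) (hq : ∑ a, q a ^ 2 = 1)
    {ω δ u η : ℝ} (hω : |∑ a, p a * q a| ≤ ω) (hωδ : ω ≤ δ) (hδ : δ < 1)
    (hu : 0 ≤ u) (hη : 0 ≤ η) :
    (stdG κ {h | ∑ a, p a * h a ∈ Set.Icc u (u + η) ∧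
      ∑ a, q a * h a ∈ Set.Icc u (u + η)}).toReal ≤
      2 * η ^ 2 / (1 - δ) * rexp (-u ^ 2 / (1 + ω)) := by
  set s := ∑ a, p a * q a with hs
  have hs' := abs_le.1 hω
  have hω0 : 0 ≤ ω := (abs_nonneg _).trans hω
  have hP : ∑ a, (p a + q a) ^ 2 = 2 + 2 * s := by
    have : ∀ a, (p a + q a) ^ 2 = p a ^ 2 + q a ^ 2 + 2 * (p a * q a) := fun a => by ring
    simp_rw [this, Finset.sum_add_distrib, ← Finset.mul_sum, hp, hq, ← hs]; ring
  have hQ : ∑ a, (p a - q a) ^ 2 = 2 - 2 * s := by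
    have : ∀ a, (p a - q a) ^ 2 = p a ^ 2 + q a ^ 2 - 2 * (p a * q a) := fun a => by ring
    simp_rw [this, Finset.sum_sub_distrib, Finset.sum_add_distrib, ← Finset.mul_sum, hp, hq,
      ← hs]
    ring
  have hPQ : ∑ a, (p a + q a) * (p a - q a) = 0 := by
    have : ∀ a, (p a + q a) * (p a - q a) = p a ^ 2 - q a ^ 2 := fun a => by ring
    simp_rw [this, Finset.sum_sub_distrib, hp, hq, sub_self]
  have hind := stdG_orthogonal_forms (fun a => p a + q a) (fun a => p a - q a) hPQ
    (measurableSet_Icc (a := 2 * u) (b := 2 * u + 2 * η)) (measurableSet_Icc (a := -η) (b := η))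
  rw [hP, hQ] at hind
  set σ := √(2 + 2 * s) with hσ
  set τ := √(2 - 2 * s) with hτ
  have hd : 0 < 1 - δ := by linarith
  have hσ0 : 0 < σ := Real.sqrt_pos.2 (by linarith)
  have hτ0 : 0 < τ := Real.sqrt_pos.2 (by linarith)
  have hset : ∀ {c A B : ℝ}, 0 < c → {x : ℝ | c * x ∈ Set.Icc A B} = Set.Icc (A / c) (B / c) := by
    intro c A B hc
    ext x
    simp [div_le_iff₀ hc, le_div_iff₀ hc, mul_comm]
  rw [hset hσ0, hset hτ0] at hind
  have hle : (stdG κ {h | ∑ a, p a * h a ∈ Set.Icc u (u + η) ∧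
      ∑ a, q a * h a ∈ Set.Icc u (u + η)}).toReal ≤
      (stdG κ {h | ∑ a, (p a + q a) * h a ∈ Set.Icc (2 * u) (2 * u + 2 * η) ∧
        ∑ a, (p a - q a) * h a ∈ Set.Icc (-η) η}).toReal := by
    refine ENNReal.toReal_mono (measure_ne_top _ _) (measure_mono ?_)
    rintro h ⟨⟨h1, h2⟩, h3, h4⟩
    simp only [Set.mem_ofPred_eq, add_mul, sub_mul, Finset.sum_add_distrib,
      Finset.sum_sub_distrib, Set.mem_Icc]
    refine ⟨⟨?_, ?_⟩, ?_, ?_⟩ <;> linarith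
  refine hle.trans ?_
  rw [hind, ENNReal.toReal_mul]
  have b1 := gaussianReal_Icc_le (a := 2 * u / σ) (b := (2 * u + 2 * η) / σ) (by positivity)
    (by gcongr; linarith)
  have b2 := gaussianReal_Icc_le_length (a := -η / τ) (b := η / τ) (by gcongr; linarith)
  refine (mul_le_mul b1 b2 ENNReal.toReal_nonneg ((ENNReal.toReal_nonneg).trans b1)).trans ?_
  have e1 : ((2 * u + 2 * η) / σ - 2 * u / σ) * rexp (-(2 * u / σ) ^ 2 / 2) *
      (η / τ - -η / τ) = 4 * η ^ 2 / (σ * τ) * rexp (-u ^ 2 / (1 + s)) := by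
    have : -(2 * u / σ) ^ 2 / 2 = -u ^ 2 / (1 + s) := by
      rw [div_pow, hσ, sq_sqrt (by linarith)]
      have : 1 + s ≠ 0 := by linarith
      field_simp
    rw [this]
    field_simp
    ring
  rw [e1]
  have e2 : 2 * (1 - δ) ≤ σ * τ := by
    have h1 : √(2 * (1 - δ)) ≤ σ := Real.sqrt_le_sqrt (by linarith)
    have h2 : √(2 * (1 - δ)) ≤ τ := Real.sqrt_le_sqrt (by linarith)
    calc 2 * (1 - δ) = √(2 * (1 - δ)) * √(2 * (1 - δ)) := (mul_self_sqrt (by linarith)).symm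
      _ ≤ σ * τ := by gcongr
  refine mul_le_mul ?_ ?_ (exp_pos _).le (by positivity)
  · calc 4 * η ^ 2 / (σ * τ) ≤ 4 * η ^ 2 / (2 * (1 - δ)) := by gcongr
      _ = 2 * η ^ 2 / (1 - δ) := by field_simp; ring
  · refine exp_le_exp.2 ?_
    rw [neg_div, neg_div, neg_le_neg_iff]
    have : 0 < 1 + s := by linarith
    gcongr
    exact hs'.2

end GaussianLaw

section SmoothTransition

lemma hasDerivAt_smoothTransition (x : ℝ) :
    HasDerivAt smoothTransition (deriv smoothTransition x) x :=
  ((smoothTransition.contDiff (n := 1)).differentiable (by norm_num) x).hasDerivAt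

lemma contDiff_deriv_smoothTransition : ContDiff ℝ 1 (deriv smoothTransition) :=
  (contDiff_succ_iff_deriv (n := 1)).1 (smoothTransition.contDiff (n := 2)) |>.2.2

lemma hasDerivAt_deriv_smoothTransition (x : ℝ) :
    HasDerivAt (deriv smoothTransition) (deriv (deriv smoothTransition) x) x :=
  (contDiff_deriv_smoothTransition.differentiable (by norm_num) x).hasDerivAt

lemma continuous_deriv_deriv_smoothTransition : Continuous (deriv (deriv smoothTransition)) :=
  contDiff_deriv_smoothTransition.continuous_deriv le_rfl

lemma deriv_eq_zero_of_eventuallyEq_const {f : ℝ → ℝ} {c x : ℝ} (h : f =ᶠ[nhds x] fun _ => c) :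
    deriv f x = 0 := by
  rw [h.deriv_eq]; simp

lemma deriv_smoothTransition_of_notMem {x : ℝ} (hx : x ∉ Set.Icc (0 : ℝ) 1) :
    deriv smoothTransition x = 0 := by
  rw [Set.mem_Icc, not_and_or, not_le, not_le] at hx
  rcases hx with hx | hx
  · refine deriv_eq_zero_of_eventuallyEq_const (c := 0) ?_
    filter_upwards [eventually_lt_nhds hx] with y hy using smoothTransition.zero_of_nonpos hy.le
  · refine deriv_eq_zero_of_eventuallyEq_const (c := 1) ?_
    filter_upwards [eventually_gt_nhds hx] with y hy using smoothTransition.one_of_one_le hy.le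

lemma deriv_deriv_smoothTransition_of_notMem {x : ℝ} (hx : x ∉ Set.Icc (0 : ℝ) 1) :
    deriv (deriv smoothTransition) x = 0 := by
  refine deriv_eq_zero_of_eventuallyEq_const (c := 0) ?_
  filter_upwards [isClosed_Icc.isOpen_compl.mem_nhds hx] with y hy
    using deriv_smoothTransition_of_notMem hy

lemma exists_bound_of_eq_zero_off_Icc {f : ℝ → ℝ} (hf : Continuous f)
    (h0 : ∀ x ∉ Set.Icc (0 : ℝ) 1, f x = 0) : ∃ C, ∀ x, |f x| ≤ C := by
  obtain ⟨C, hC⟩ := (isCompact_Icc (a := (0 : ℝ)) (b := 1)).exists_bound_of_continuousOn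
    hf.continuousOn
  refine ⟨max C 0, fun x => ?_⟩
  by_cases hx : x ∈ Set.Icc (0 : ℝ) 1
  · exact (hC x hx).trans (le_max_left _ _)
  · simp [h0 x hx]

lemma exists_bound_deriv_smoothTransition : ∃ C : ℝ, 1 ≤ C ∧
    (∀ x, |deriv smoothTransition x| ≤ C) ∧ ∀ x, |deriv (deriv smoothTransition) x| ≤ C := by
  obtain ⟨C₁, h₁⟩ := exists_bound_of_eq_zero_off_Icc contDiff_deriv_smoothTransition.continuous
    fun x => deriv_smoothTransition_of_notMem
  obtain ⟨C₂, h₂⟩ := exists_bound_of_eq_zero_off_Icc continuous_deriv_deriv_smoothTransition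
    fun x => deriv_deriv_smoothTransition_of_notMem
  exact ⟨max 1 (max C₁ C₂), le_max_left _ _, fun x => (h₁ x).trans (by simp),
    fun x => (h₂ x).trans (by simp)⟩

end SmoothTransition

section HasGrad

variable {ι : Type*} [Fintype ι] {F H : (ι → ℝ) → ℝ} {F' H' : ι → (ι → ℝ) → ℝ}

lemma HasGrad.mul (hF : HasGrad F F') (hH : HasGrad H H') :
    HasGrad (fun v => F v * H v) (fun i v => F' i v * H v + F v * H' i v) := by
  intro c c' x hc
  refine ((hF c c' x hc).mul (hH c c' x hc)).congr_deriv ?_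
  rw [Finset.sum_mul, Finset.mul_sum, ← Finset.sum_add_distrib]
  exact Finset.sum_congr rfl fun i _ => by ring

lemma HasGrad.add (hF : HasGrad F F') (hH : HasGrad H H') :
    HasGrad (fun v => F v + H v) (fun i v => F' i v + H' i v) := by
  intro c c' x hc
  refine ((hF c c' x hc).add (hH c c' x hc)).congr_deriv ?_
  rw [← Finset.sum_add_distrib]
  exact Finset.sum_congr rfl fun i _ => by ring

lemma hasGrad_comp_sum {G G' f f' : ℝ → ℝ} (w : ι → ℝ) (hG : ∀ x, HasDerivAt G (G' x) x)
    (hf : ∀ x, HasDerivAt f (f' x) x) :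
    HasGrad (fun v => G (∑ i, w i * f (v i)))
      (fun i v => G' (∑ i, w i * f (v i)) * (w i * f' (v i))) := by
  intro c c' x hc
  have h1 : HasDerivAt (fun t => ∑ i, w i * f (c t i)) (∑ i, w i * (f' (c x i) * c' i)) x :=
    HasDerivAt.fun_sum fun i _ => ((hf (c x i)).comp x (hc i)).const_mul (w i)
  refine ((hG _).comp x h1).congr_deriv ?_
  rw [Finset.mul_sum]
  exact Finset.sum_congr rfl fun i _ => by ring

lemma hasGrad_coord {f f' : ℝ → ℝ} (w : ι → ℝ) (i : ι) (hf : ∀ x, HasDerivAt f (f' x) x) :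
    HasGrad (fun v : ι → ℝ => w i * f (v i)) (fun j v => if j = i then w i * f' (v i) else 0) := by
  intro c c' x hc
  refine (((hf (c x i)).comp x (hc i)).const_mul (w i)).congr_deriv ?_
  simp [ite_mul, mul_assoc]

end HasGrad

section CountTest

variable {ι : Type*} [Fintype ι]

/-- A smooth cutoff equal to `1` on `(-∞, K]` and to `0` on `[K + 1, ∞)`. -/
noncomputable def cutoff (K t : ℝ) : ℝ := 1 - smoothTransition (t - K)

/-- A smooth step from `0` (left of `u`) to `1` (right of `u + η`). -/
noncomputable def step (u η t : ℝ) : ℝ := smoothTransition ((t - u) / η)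

lemma hasDerivAt_cutoff (K t : ℝ) :
    HasDerivAt (cutoff K) (-deriv smoothTransition (t - K)) t := by
  have := ((hasDerivAt_smoothTransition (t - K)).comp_sub_const t K).const_sub 1
  exact this

lemma hasDerivAt_cutoff' (K t : ℝ) :
    HasDerivAt (fun t => -deriv smoothTransition (t - K))
      (-deriv (deriv smoothTransition) (t - K)) t :=
  ((hasDerivAt_deriv_smoothTransition (t - K)).comp_sub_const t K).fun_neg

lemma hasDerivAt_step (u η t : ℝ) :
    HasDerivAt (step u η) (deriv smoothTransition ((t - u) / η) / η) t := by
  have h1 : HasDerivAt (fun t => (t - u) / η) (1 / η) t :=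
    ((hasDerivAt_id t).sub_const u).div_const η
  refine ((hasDerivAt_smoothTransition _).comp t h1).congr_deriv (by ring)

lemma hasDerivAt_step' (u η t : ℝ) :
    HasDerivAt (fun t => deriv smoothTransition ((t - u) / η) / η)
      (deriv (deriv smoothTransition) ((t - u) / η) / η / η) t := by
  have h1 : HasDerivAt (fun t => (t - u) / η) (1 / η) t :=
    ((hasDerivAt_id t).sub_const u).div_const η
  refine (((hasDerivAt_deriv_smoothTransition _).comp t h1).div_const η).congr_deriv (by ring)

/-- The smoothed indicator of `{#marked exceedances of u₁ ≤ K, #exceedances of u₂ ≤ M}`. -/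
noncomputable def countTest (e : ι → ℝ) (K M u₁ u₂ η : ℝ) (v : ι → ℝ) : ℝ :=
  cutoff K (∑ i, e i * step u₁ η (v i)) * cutoff M (∑ i, 1 * step u₂ η (v i))

/-- Gradient of `countTest`. -/
noncomputable def countTest' (e : ι → ℝ) (K M u₁ u₂ η : ℝ) (i : ι) (v : ι → ℝ) : ℝ :=
  -deriv smoothTransition (∑ i, e i * step u₁ η (v i) - K) *
      (e i * (deriv smoothTransition ((v i - u₁) / η) / η)) *
      cutoff M (∑ i, 1 * step u₂ η (v i)) +
    cutoff K (∑ i, e i * step u₁ η (v i)) *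
      (-deriv smoothTransition (∑ i, 1 * step u₂ η (v i) - M) *
        (1 * (deriv smoothTransition ((v i - u₂) / η) / η)))

/-- Hessian of `countTest`. -/
noncomputable def countTest'' (e : ι → ℝ) (K M u₁ u₂ η : ℝ) (i j : ι) (v : ι → ℝ) : ℝ :=
  let s₁ := ∑ i, e i * step u₁ η (v i)
  let s₂ := ∑ i, 1 * step u₂ η (v i)
  let d₁ := fun i => e i * (deriv smoothTransition ((v i - u₁) / η) / η)
  let d₂ := fun i => 1 * (deriv smoothTransition ((v i - u₂) / η) / η)
  ((-deriv (deriv smoothTransition) (s₁ - K) * d₁ j) * d₁ i +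
      -deriv smoothTransition (s₁ - K) *
        (if j = i then e i * (deriv (deriv smoothTransition) ((v i - u₁) / η) / η / η) else 0)) *
      cutoff M s₂ +
    (-deriv smoothTransition (s₁ - K) * d₁ i) * (-deriv smoothTransition (s₂ - M) * d₂ j) +
    ((-deriv smoothTransition (s₁ - K) * d₁ j) * (-deriv smoothTransition (s₂ - M) * d₂ i) +
    cutoff K s₁ * ((-deriv (deriv smoothTransition) (s₂ - M) * d₂ j) * d₂ i +
      -deriv smoothTransition (s₂ - M) *
        (if j = i then 1 * (deriv (deriv smoothTransition) ((v i - u₂) / η) / η / η) else 0)))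

lemma hasGrad_countTest (e : ι → ℝ) (K M u₁ u₂ η : ℝ) :
    HasGrad (countTest e K M u₁ u₂ η) (countTest' e K M u₁ u₂ η) :=
  (hasGrad_comp_sum e (hasDerivAt_cutoff K) (hasDerivAt_step u₁ η)).mul
    (hasGrad_comp_sum (fun _ => 1) (hasDerivAt_cutoff M) (hasDerivAt_step u₂ η))

lemma hasGrad_countTest' (e : ι → ℝ) (K M u₁ u₂ η : ℝ) (i : ι) :
    HasGrad (countTest' e K M u₁ u₂ η i) (countTest'' e K M u₁ u₂ η i) :=
  (((hasGrad_comp_sum e (hasDerivAt_cutoff' K) (hasDerivAt_step u₁ η)).mul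
      (hasGrad_coord e i (hasDerivAt_step' u₁ η))).mul
    (hasGrad_comp_sum (fun _ => 1) (hasDerivAt_cutoff M) (hasDerivAt_step u₂ η))).add
  ((hasGrad_comp_sum e (hasDerivAt_cutoff K) (hasDerivAt_step u₁ η)).mul
    ((hasGrad_comp_sum (fun _ => 1) (hasDerivAt_cutoff' M) (hasDerivAt_step u₂ η)).mul
      (hasGrad_coord (fun _ => 1) i (hasDerivAt_step' u₂ η))))

lemma measurable_smoothTransition : Measurable smoothTransition :=
  smoothTransition.continuous.measurable

lemma measurable_countTest (e : ι → ℝ) (K M u₁ u₂ η : ℝ) :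
    Measurable (countTest e K M u₁ u₂ η) := by
  have := measurable_smoothTransition
  unfold countTest cutoff step
  fun_prop

lemma measurable_countTest' (e : ι → ℝ) (K M u₁ u₂ η : ℝ) (i : ι) :
    Measurable (countTest' e K M u₁ u₂ η i) := by
  have := measurable_smoothTransition
  have h1 := contDiff_deriv_smoothTransition.continuous.measurable
  unfold countTest' cutoff step
  fun_prop

lemma measurable_countTest'' (e : ι → ℝ) (K M u₁ u₂ η : ℝ) (i j : ι) :
    Measurable (countTest'' e K M u₁ u₂ η i j) := by
  have := measurable_smoothTransition
  have h1 := contDiff_deriv_smoothTransition.continuous.measurable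
  have h2 := continuous_deriv_deriv_smoothTransition.measurable
  unfold countTest'' cutoff step
  by_cases h : j = i
  · simp only [if_pos h]; fun_prop
  · simp only [if_neg h]; fun_prop

lemma cutoff_nonneg (K t : ℝ) : 0 ≤ cutoff K t := sub_nonneg.2 (smoothTransition.le_one _)

lemma cutoff_le_one (K t : ℝ) : cutoff K t ≤ 1 := by
  unfold cutoff; linarith [smoothTransition.nonneg (t - K)]

lemma abs_cutoff_le_one (K t : ℝ) : |cutoff K t| ≤ 1 :=
  abs_le.2 ⟨by linarith [cutoff_nonneg K t], cutoff_le_one K t⟩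

lemma abs_countTest_le (e : ι → ℝ) (K M u₁ u₂ η : ℝ) (v : ι → ℝ) :
    |countTest e K M u₁ u₂ η v| ≤ 1 := by
  unfold countTest
  rw [abs_mul]
  exact mul_le_one₀ (abs_cutoff_le_one _ _) (abs_nonneg _) (abs_cutoff_le_one _ _)

end CountTest

lemma abs_hessian_le {C D₁ D₂ D₃ D₄ c₁ c₂ d₁ d₂ d₁' d₂' r₁ r₂ p p' r : ℝ} (hC : 1 ≤ C)
    (hD₁ : |D₁| ≤ C) (hD₂ : |D₂| ≤ C) (hD₃ : |D₃| ≤ C) (hD₄ : |D₄| ≤ C)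
    (hc₁ : |c₁| ≤ 1) (hc₂ : |c₂| ≤ 1) (hd₁ : |d₁| ≤ p) (hd₂ : |d₂| ≤ p)
    (hd₁' : |d₁'| ≤ p') (hd₂' : |d₂'| ≤ p') (hr₁ : |r₁| ≤ r) (hr₂ : |r₂| ≤ r) :
    |((-D₂ * d₁') * d₁ + -D₁ * r₁) * c₂ + (-D₁ * d₁) * (-D₃ * d₂') +
      ((-D₁ * d₁') * (-D₃ * d₂) + c₁ * ((-D₄ * d₂') * d₂ + -D₃ * r₂))| ≤
      4 * C ^ 2 * (p * p') + 2 * C * r := by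
  have hp : 0 ≤ p := (abs_nonneg _).trans hd₁
  have hp' : 0 ≤ p' := (abs_nonneg _).trans hd₁'
  have hr : 0 ≤ r := (abs_nonneg _).trans hr₁
  have hC0 : 0 ≤ C := by linarith
  have key : ∀ a b c s : ℝ, |c| ≤ 1 → |a| ≤ C * p' * p → |b| ≤ C * r →
      |(a + b) * c| ≤ C ^ 2 * (p * p') + C * r := by
    intro a b c s hc ha hb
    rw [abs_mul]
    have h1 : |a + b| ≤ C * p' * p + C * r := (abs_add_le _ _).trans (add_le_add ha hb)
    have h2 : |a + b| * |c| ≤ |a + b| := mul_le_of_le_one_right (abs_nonneg _) hc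
    have h3 : C * p' * p ≤ C ^ 2 * (p * p') := by
      nlinarith [mul_nonneg (mul_nonneg hC0 (sub_nonneg.2 hC)) (mul_nonneg hp hp')]
    linarith
  have h3 : ∀ D d d' : ℝ, |D| ≤ C → |d| ≤ p → |d'| ≤ p' → |(-D * d') * d| ≤ C * p' * p := by
    intro D d d' hD hd hd'
    rw [abs_mul, abs_mul, abs_neg]; gcongr
  have h4 : ∀ D r' : ℝ, |D| ≤ C → |r'| ≤ r → |-D * r'| ≤ C * r := by
    intro D r' hD hd
    rw [abs_mul, abs_neg]; gcongr
  have h5 : ∀ D D' d d' : ℝ, |D| ≤ C → |D'| ≤ C → |d| ≤ p → |d'| ≤ p' →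
      |(-D * d) * (-D' * d')| ≤ C ^ 2 * (p * p') := by
    intro D D' d d' hD hD' hd hd'
    rw [abs_mul, abs_mul, abs_mul, abs_neg, abs_neg]
    calc |D| * |d| * (|D'| * |d'|) ≤ C * p * (C * p') := by gcongr
      _ = _ := by ring
  have t1 := key _ _ c₂ 0 hc₂ (h3 D₂ d₁ d₁' hD₂ hd₁ hd₁') (h4 D₁ r₁ hD₁ hr₁)
  have t4 := key _ _ c₁ 0 hc₁ (h3 D₄ d₂ d₂' hD₄ hd₂ hd₂') (h4 D₃ r₂ hD₃ hr₂)
  have t2 := h5 D₁ D₃ d₁ d₂' hD₁ hD₃ hd₁ hd₂'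
  have t3 := h5 D₃ D₁ d₂ d₁' hD₃ hD₁ hd₂ hd₁'
  rw [mul_comm] at t3 t4
  refine (abs_add_le _ _).trans ((add_le_add (abs_add_le _ _) (abs_add_le _ _)).trans ?_)
  linarith

section Bounds

variable {ι : Type*} [Fintype ι] {C : ℝ} {e : ι → ℝ} {K M u₁ u₂ η : ℝ}

lemma abs_deriv_step_le (h1 : ∀ x, |deriv smoothTransition x| ≤ C) (hη : 0 < η) {w t u a b : ℝ}
    (hw : |w| ≤ 1) (hau : a ≤ u) (hub : u + η ≤ b) :
    |w * (deriv smoothTransition ((t - u) / η) / η)| ≤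
      C / η * (Set.Icc a b).indicator 1 t := by
  by_cases ht : t ∈ Set.Icc a b
  · rw [Set.indicator_of_mem ht, Pi.one_apply, mul_one, abs_mul, abs_div, abs_of_pos hη]
    have : |deriv smoothTransition ((t - u) / η)| / η ≤ C / η := by gcongr; exact h1 _
    exact (mul_le_of_le_one_left (by positivity) hw).trans this
  · rw [Set.indicator_of_notMem ht, mul_zero, deriv_smoothTransition_of_notMem]
    · simp
    · rintro ⟨h0, h1⟩
      rw [le_div_iff₀ hη] at h0
      rw [div_le_one hη] at h1
      exact ht ⟨by linarith, by linarith⟩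

lemma abs_countTest'_le (hC : 1 ≤ C) (h1 : ∀ x, |deriv smoothTransition x| ≤ C) (hη : 0 < η)
    (he : ∀ i, |e i| ≤ 1) (i : ι) (v : ι → ℝ) :
    |countTest' e K M u₁ u₂ η i v| ≤ 2 * C * (C / η) := by
  have hb : ∀ w u : ℝ, |w| ≤ 1 → |w * (deriv smoothTransition ((v i - u) / η) / η)| ≤ C / η := by
    intro w u hw
    rw [abs_mul, abs_div, abs_of_pos hη]
    have : |deriv smoothTransition ((v i - u) / η)| / η ≤ C / η := by gcongr; exact h1 _
    exact (mul_le_of_le_one_left (by positivity) hw).trans this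
  have hb2 : ∀ D d c : ℝ, |D| ≤ C → |d| ≤ C / η → |c| ≤ 1 → |-D * d * c| ≤ C * (C / η) := by
    intro D d c hD hd hc
    rw [abs_mul, abs_mul, abs_neg]
    refine (mul_le_of_le_one_right (by positivity) hc).trans ?_
    gcongr
  unfold countTest'
  refine (abs_add_le _ _).trans ?_
  have t1 := hb2 (deriv smoothTransition (∑ i, e i * step u₁ η (v i) - K)) _
    (cutoff M (∑ i, 1 * step u₂ η (v i))) (h1 _) (hb (e i) u₁ (he i)) (abs_cutoff_le_one _ _)
  have t2 := hb2 (deriv smoothTransition (∑ i, 1 * step u₂ η (v i) - M)) _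
    (cutoff K (∑ i, e i * step u₁ η (v i))) (h1 _) (hb 1 u₂ (by simp)) (abs_cutoff_le_one _ _)
  rw [mul_comm] at t2
  linarith

lemma abs_countTest''_le (hC : 1 ≤ C) (h1 : ∀ x, |deriv smoothTransition x| ≤ C)
    (h2 : ∀ x, |deriv (deriv smoothTransition) x| ≤ C) (hη : 0 < η)
    (hu : u₂ ≤ u₁) (he : ∀ i, |e i| ≤ 1) (i j : ι) (v : ι → ℝ) :
    |countTest'' e K M u₁ u₂ η i j v| ≤
      4 * C ^ 2 * ((C / η * (Set.Icc u₂ (u₁ + η)).indicator 1 (v i)) *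
        (C / η * (Set.Icc u₂ (u₁ + η)).indicator 1 (v j))) +
      2 * C * (if j = i then C / η / η else 0) := by
  have hr : ∀ w u : ℝ, |w| ≤ 1 → |if j = i then
      w * (deriv (deriv smoothTransition) ((v i - u) / η) / η / η) else 0| ≤
      if j = i then C / η / η else 0 := by
    intro w u hw
    split_ifs
    · rw [abs_mul, abs_div, abs_div, abs_of_pos hη]
      have : |deriv (deriv smoothTransition) ((v i - u) / η)| / η / η ≤ C / η / η := by
        gcongr; exact h2 _
      exact (mul_le_of_le_one_left (by positivity) hw).trans this
    · simp
  exact abs_hessian_le hC (h1 _) (h2 _) (h1 _) (h2 _) (abs_cutoff_le_one _ _)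
    (abs_cutoff_le_one _ _)
    (abs_deriv_step_le h1 hη (he i) hu le_rfl)
    (abs_deriv_step_le h1 hη (by simp) le_rfl (by linarith))
    (abs_deriv_step_le h1 hη (he j) hu le_rfl)
    (abs_deriv_step_le h1 hη (by simp) le_rfl (by linarith)) (hr _ _ (he i)) (hr _ _ (by simp))

/-- Normal comparison for the smoothed counting functional. -/
lemma abs_integral_countTest_sub_le {κ : Type*} [Fintype κ]
    (hC : 1 ≤ C) (h1 : ∀ x, |deriv smoothTransition x| ≤ C)
    (h2 : ∀ x, |deriv (deriv smoothTransition) x| ≤ C) (hη : 0 < η)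
    (hu : u₂ ≤ u₁) (hu0 : 0 ≤ u₂) (he : ∀ i, |e i| ≤ 1) {A B : ι → κ → ℝ}
    (hAB : ∀ i j, ∑ a, A i a * B j a = 0) (hA : ∀ i, ∑ a, A i a * A i a = 1)
    (hB : ∀ i, ∑ a, B i a * B i a = 1) {ω : ι → ι → ℝ} {δ : ℝ} (hδ : δ < 1)
    (hωδ : ∀ i j, i ≠ j → ω i j ≤ δ)
    (hωA : ∀ i j, i ≠ j → |∑ a, A i a * A j a| ≤ ω i j)
    (hωB : ∀ i j, i ≠ j → |∑ a, B i a * B j a| ≤ ω i j) :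
    |∫ h, countTest e K M u₁ u₂ η (fun i => ∑ a, B i a * h a) ∂stdG κ -
      ∫ h, countTest e K M u₁ u₂ η (fun i => ∑ a, A i a * h a) ∂stdG κ| ≤
      2 * ∑ i, ∑ j, if i = j then 0 else
        |∑ a, B i a * B j a - ∑ a, A i a * A j a| * (4 * C ^ 2 * (C / η) ^ 2 *
          (2 * (u₁ - u₂ + η) ^ 2 / (1 - δ) * rexp (-u₂ ^ 2 / (1 + ω i j)))) := by
  set W := Set.Icc u₂ (u₁ + η) with hW
  set D := 1 + 2 * C * (C / η) + 4 * C ^ 2 * ((C / η) * (C / η)) + 2 * C * (C / η / η) with hD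
  have hC0 : 0 < C := by linarith
  have hp1 : 0 ≤ 2 * C * (C / η) := by positivity
  have hp2 : 0 ≤ 4 * C ^ 2 * ((C / η) * (C / η)) := by positivity
  have hp3 : 0 ≤ 2 * C * (C / η / η) := by positivity
  have hind : ∀ t, C / η * W.indicator 1 t ≤ C / η := fun t =>
    mul_le_of_le_one_right (by positivity) (Set.indicator_le_self' (by simp) t)
  have hind0 : ∀ t, 0 ≤ C / η * W.indicator 1 t := fun t =>
    mul_nonneg (by positivity) (Set.indicator_nonneg (by simp) t)
  refine abs_integral_rotMap_sub_le (C := D) (hasGrad_countTest e K M u₁ u₂ η)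
    (hasGrad_countTest' e K M u₁ u₂ η) (measurable_countTest e K M u₁ u₂ η)
    (measurable_countTest' e K M u₁ u₂ η) (measurable_countTest'' e K M u₁ u₂ η)
    (fun v => (abs_countTest_le e K M u₁ u₂ η v).trans (by linarith))
    (fun i v => (abs_countTest'_le hC h1 hη he i v).trans (by linarith))
    (fun i j v => (abs_countTest''_le hC h1 h2 hη hu he i j v).trans ?_) hAB _ ?_
  · have t1 : (C / η * W.indicator 1 (v i)) * (C / η * W.indicator 1 (v j)) ≤ C / η * (C / η) :=
      mul_le_mul (hind _) (hind _) (hind0 _) (by positivity)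
    have t2 : (if j = i then C / η / η else 0) ≤ C / η / η := by
      split_ifs
      · exact le_rfl
      · positivity
    have t3 := mul_le_mul_of_nonneg_left t1 (by positivity : 0 ≤ 4 * C ^ 2)
    have t4 := mul_le_mul_of_nonneg_left t2 (by positivity : 0 ≤ 2 * C)
    linarith
  intro θ i j
  by_cases hij : i = j
  · subst hij; simp [hA, hB]
  rw [if_neg hij]
  refine mul_le_mul_of_nonneg_left ?_ (abs_nonneg _)
  set p : ι → κ → ℝ := fun i a => cos θ * A i a + sin θ * B i a with hp
  have hpp : ∀ i j, ∑ a, p i a * p j a =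
      cos θ ^ 2 * ∑ a, A i a * A j a + sin θ ^ 2 * ∑ a, B i a * B j a := by
    intro i j
    have h := hAB i j
    have h' := hAB j i
    have : ∑ a, p i a * p j a = cos θ ^ 2 * ∑ a, A i a * A j a + sin θ ^ 2 * ∑ a, B i a * B j a +
        cos θ * sin θ * ∑ a, A i a * B j a + cos θ * sin θ * ∑ a, A j a * B i a := by
      simp only [Finset.mul_sum, ← Finset.sum_add_distrib, hp]
      exact Finset.sum_congr rfl fun a _ => by ring
    rw [this, h, h']; ring
  have hunit : ∀ i, ∑ a, p i a ^ 2 = 1 := by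
    intro i
    simp_rw [sq]
    rw [hpp, hA, hB, mul_one, mul_one, cos_sq_add_sin_sq]
  have hcov : |∑ a, p i a * p j a| ≤ ω i j := by
    rw [hpp]
    refine (abs_add_le _ _).trans ?_
    rw [abs_mul, abs_mul, abs_of_nonneg (sq_nonneg (cos θ)), abs_of_nonneg (sq_nonneg (sin θ))]
    calc _ ≤ cos θ ^ 2 * ω i j + sin θ ^ 2 * ω i j := by
          gcongr
          · exact hωA i j hij
          · exact hωB i j hij
      _ = ω i j := by rw [← add_mul, cos_sq_add_sin_sq, one_mul]
  have hw := stdG_pair_window_le (p i) (p j) (hunit i) (hunit j) hcov (hωδ i j hij) hδ hu0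
    (show 0 ≤ u₁ - u₂ + η by linarith)
  have hWe : u₂ + (u₁ - u₂ + η) = u₁ + η := by ring
  rw [hWe] at hw
  set Sset := {h : κ → ℝ | ∑ a, p i a * h a ∈ W ∧ ∑ a, p j a * h a ∈ W} with hS
  have hSm : MeasurableSet Sset := by
    have m1 : Measurable fun h : κ → ℝ => ∑ a, p i a * h a := by fun_prop
    have m2 : Measurable fun h : κ → ℝ => ∑ a, p j a * h a := by fun_prop
    exact (m1 measurableSet_Icc).inter (m2 measurableSet_Icc)
  calc ∫ h, |countTest'' e K M u₁ u₂ η i j (rotMap A B θ h)| ∂stdG κ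
      ≤ ∫ h, Sset.indicator (fun _ => 4 * C ^ 2 * (C / η) ^ 2) h ∂stdG κ := by
        refine integral_mono_of_nonneg (Eventually.of_forall fun h => abs_nonneg _)
          ((integrable_const _).indicator hSm) (Eventually.of_forall fun h => ?_)
        refine (abs_countTest''_le hC h1 h2 hη hu he i j _).trans ?_
        rw [if_neg (Ne.symm hij), mul_zero, add_zero]
        by_cases hh : h ∈ Sset
        · rw [Set.indicator_of_mem hh, sq (C / η)]
          exact mul_le_mul_of_nonneg_left
            (mul_le_mul (hind _) (hind _) (hind0 _) (by positivity)) (by positivity)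
        · rw [Set.indicator_of_notMem hh]
          have : ¬ (rotMap A B θ h i ∈ W ∧ rotMap A B θ h j ∈ W) := hh
          rcases not_and_or.1 this with h' | h'
          · rw [Set.indicator_of_notMem h']; simp
          · rw [Set.indicator_of_notMem h']; simp
    _ = 4 * C ^ 2 * (C / η) ^ 2 * (stdG κ Sset).toReal := by
        rw [integral_indicator hSm, setIntegral_const, smul_eq_mul, mul_comm]; rfl
    _ ≤ _ := mul_le_mul_of_nonneg_left hw (by positivity)

end Bounds

/-- `μ` is the centered Gaussian law with covariance matrix `S`. -/
structure GaussCov {ι : Type*} [Fintype ι] (μ : Measure (ι → ℝ)) (S : ι → ι → ℝ) : Prop where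
  symm : ∀ i j, S i j = S j i
  nonneg : ∀ c : ι → ℝ, 0 ≤ ∑ i, ∑ j, c i * c j * S i j
  map_eq : ∀ c : ι → ℝ, μ.map (fun v => ∑ i, c i * v i) =
    gaussianReal 0 (∑ i, ∑ j, c i * c j * S i j).toNNReal

/-- At most `K` marked exceedances of `u₁` and at most `M` exceedances of `u₂`. -/
def countEvent {ι : Type*} [Fintype ι] (e : ι → Bool) (K M : ℕ) (u₁ u₂ : ℝ) : Set (ι → ℝ) :=
  {v | (Finset.univ.filter fun i => u₁ < v i ∧ e i = true).card ≤ K ∧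
    (Finset.univ.filter fun i => u₂ < v i).card ≤ M}

section Sandwich

variable {ι : Type*} [Fintype ι] {e : ι → Bool} {K M : ℕ} {u₁ u₂ η : ℝ}

lemma measurableSet_countEvent : MeasurableSet (countEvent e K M u₁ u₂) := by
  have h1 : Measurable fun v : ι → ℝ =>
      (Finset.univ.filter fun i => u₁ < v i ∧ e i = true).card := by
    simp_rw [Finset.card_filter]
    exact Finset.measurable_fun_sum _ fun i _ => Measurable.ite
      ((measurableSet_lt measurable_const (measurable_pi_apply i)).inter (MeasurableSet.const _))
      measurable_const measurable_const
  have h2 : Measurable fun v : ι → ℝ => (Finset.univ.filter fun i => u₂ < v i).card := by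
    simp_rw [Finset.card_filter]
    exact Finset.measurable_fun_sum _ fun i _ => Measurable.ite
      (measurableSet_lt measurable_const (measurable_pi_apply i)) measurable_const measurable_const
  exact (measurableSet_le h1 measurable_const).inter (measurableSet_le h2 measurable_const)

lemma step_of_notMem (hη : 0 < η) {u t : ℝ} (ht : t ∉ Set.Icc u (u + η)) :
    step u η t = if u < t then 1 else 0 := by
  unfold step
  rw [Set.mem_Icc, not_and_or, not_le, not_le] at ht
  split_ifs with h
  · refine smoothTransition.one_of_one_le ((one_le_div hη).2 ?_)
    rcases ht with ht | ht <;> linarith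
  · exact smoothTransition.zero_of_nonpos (div_nonpos_of_nonpos_of_nonneg (by linarith) hη.le)

lemma cutoff_natCast (K c : ℕ) : cutoff K c = if c ≤ K then 1 else 0 := by
  unfold cutoff
  split_ifs with h
  · rw [smoothTransition.zero_of_nonpos, sub_zero]
    exact sub_nonpos.2 (by exact_mod_cast h)
  · rw [smoothTransition.one_of_one_le, sub_self]
    have : (K : ℝ) + 1 ≤ c := by exact_mod_cast not_le.1 h
    linarith

lemma countTest_eq_indicator (hη : 0 < η) {v : ι → ℝ}
    (h₁ : ∀ i, v i ∉ Set.Icc u₁ (u₁ + η)) (h₂ : ∀ i, v i ∉ Set.Icc u₂ (u₂ + η)) :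
    countTest (fun i => if e i = true then 1 else 0) K M u₁ u₂ η v =
      (countEvent e K M u₁ u₂).indicator 1 v := by
  have t1 : ∑ i, (if e i = true then (1 : ℝ) else 0) * step u₁ η (v i) =
      ((Finset.univ.filter fun i => u₁ < v i ∧ e i = true).card : ℝ) := by
    rw [Finset.card_filter, Nat.cast_sum]
    refine Finset.sum_congr rfl fun i _ => ?_
    rw [step_of_notMem hη (h₁ i)]
    by_cases a : u₁ < v i <;> by_cases b : e i = true <;> simp [a, b]
  have t2 : ∑ i, 1 * step u₂ η (v i) =
      ((Finset.univ.filter fun i => u₂ < v i).card : ℝ) := by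
    rw [Finset.card_filter, Nat.cast_sum]
    refine Finset.sum_congr rfl fun i _ => ?_
    rw [step_of_notMem hη (h₂ i)]
    by_cases a : u₂ < v i <;> simp [a]
  unfold countTest
  rw [t1, t2, cutoff_natCast, cutoff_natCast, Set.indicator_apply]
  unfold countEvent
  by_cases a : (Finset.univ.filter fun i => u₁ < v i ∧ e i = true).card ≤ K <;>
    by_cases b : (Finset.univ.filter fun i => u₂ < v i).card ≤ M <;> simp [a, b]

lemma abs_measure_countEvent_sub_le {μ : Measure (ι → ℝ)} [IsProbabilityMeasure μ]
    (hμ : ∀ i, μ.map (fun v => v i) = gaussianReal 0 1) (hη : 0 < η) (hu0 : 0 ≤ u₂)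
    (hu : u₂ ≤ u₁) :
    |(μ (countEvent e K M u₁ u₂)).toReal -
      ∫ v, countTest (fun i => if e i = true then 1 else 0) K M u₁ u₂ η v ∂μ| ≤
      2 * Fintype.card ι * (η * rexp (-u₂ ^ 2 / 2)) := by
  set F := countTest (fun i => if e i = true then (1 : ℝ) else 0) K M u₁ u₂ η with hF
  set Ev := countEvent e K M u₁ u₂
  have hEv : MeasurableSet Ev := measurableSet_countEvent
  set W : ι → Set (ι → ℝ) := fun i => {v | v i ∈ Set.Icc u₁ (u₁ + η)} with hW
  set W' : ι → Set (ι → ℝ) := fun i => {v | v i ∈ Set.Icc u₂ (u₂ + η)} with hW'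
  have hWm : ∀ i, MeasurableSet (W i) := fun i => measurable_pi_apply i measurableSet_Icc
  have hWm' : ∀ i, MeasurableSet (W' i) := fun i => measurable_pi_apply i measurableSet_Icc
  have hFi : Integrable F μ :=
    Integrable.of_bound (measurable_countTest _ _ _ _ _ _).aestronglyMeasurable 1
      (Eventually.of_forall fun v => abs_countTest_le _ _ _ _ _ _ v)
  have hI : Integrable (Ev.indicator (1 : (ι → ℝ) → ℝ)) μ :=
    (integrable_const (1 : ℝ)).indicator hEv
  have e1 : (μ Ev).toReal = ∫ v, Ev.indicator 1 v ∂μ := by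
    rw [integral_indicator_one hEv]; rfl
  rw [e1, ← integral_sub hI hFi]
  have hbd : ∀ v, ‖Ev.indicator (1 : (ι → ℝ) → ℝ) v - F v‖ ≤
      ∑ i, ((W i).indicator 1 v + (W' i).indicator 1 v) := by
    intro v
    have hnn : ∀ i, 0 ≤ (W i).indicator (1 : (ι → ℝ) → ℝ) v + (W' i).indicator 1 v := fun i =>
      add_nonneg (Set.indicator_nonneg (by simp) _) (Set.indicator_nonneg (by simp) _)
    by_cases hv : ∀ i, v ∉ W i ∧ v ∉ W' i
    · rw [hF, countTest_eq_indicator hη (fun i => (hv i).1) (fun i => (hv i).2), sub_self,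
        norm_zero]
      exact Finset.sum_nonneg fun i _ => hnn i
    · push Not at hv
      obtain ⟨i, hi⟩ := hv
      have h1 : 1 ≤ (W i).indicator (1 : (ι → ℝ) → ℝ) v + (W' i).indicator 1 v := by
        by_cases a : v ∈ W i
        · rw [Set.indicator_of_mem a, Pi.one_apply]
          linarith [Set.indicator_nonneg (s := W' i) (f := (1 : (ι → ℝ) → ℝ)) (by simp) v]
        · rw [Set.indicator_of_mem (hi a), Pi.one_apply]
          linarith [Set.indicator_nonneg (s := W i) (f := (1 : (ι → ℝ) → ℝ)) (by simp) v]
      have h2 : 0 ≤ F v ∧ F v ≤ 1 := ⟨mul_nonneg (cutoff_nonneg _ _) (cutoff_nonneg _ _),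
        (le_abs_self _).trans (abs_countTest_le _ _ _ _ _ _ v)⟩
      have h3 : 0 ≤ Ev.indicator (1 : (ι → ℝ) → ℝ) v := Set.indicator_nonneg (by simp) _
      have h4 : Ev.indicator (1 : (ι → ℝ) → ℝ) v ≤ 1 := Set.indicator_le_self' (by simp) _
      refine le_trans ?_ (h1.trans (Finset.single_le_sum (fun i _ => hnn i) (Finset.mem_univ i)))
      rw [Real.norm_eq_abs, abs_le]
      constructor <;> linarith [h2.1, h2.2]
  have hWi : ∀ i, Integrable ((W i).indicator (1 : (ι → ℝ) → ℝ)) μ := fun i =>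
    (integrable_const (1 : ℝ)).indicator (hWm i)
  have hWi' : ∀ i, Integrable ((W' i).indicator (1 : (ι → ℝ) → ℝ)) μ := fun i =>
    (integrable_const (1 : ℝ)).indicator (hWm' i)
  have hmeas : ∀ i u, u₂ ≤ u → (μ {v | v i ∈ Set.Icc u (u + η)}).toReal ≤
      η * rexp (-u₂ ^ 2 / 2) := by
    intro i u hle
    have : μ {v | v i ∈ Set.Icc u (u + η)} = gaussianReal 0 1 (Set.Icc u (u + η)) := by
      rw [← hμ i, Measure.map_apply (measurable_pi_apply i) measurableSet_Icc]; rfl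
    rw [this]
    refine (gaussianReal_Icc_le (hu0.trans hle) (by linarith)).trans ?_
    rw [add_sub_cancel_left]
    gcongr
  have hIW : ∀ i, ∫ v, (W i).indicator (1 : (ι → ℝ) → ℝ) v ∂μ ≤ η * rexp (-u₂ ^ 2 / 2) :=
    fun i => by rw [integral_indicator_one (hWm i)]; exact hmeas i u₁ hu
  have hIW' : ∀ i, ∫ v, (W' i).indicator (1 : (ι → ℝ) → ℝ) v ∂μ ≤ η * rexp (-u₂ ^ 2 / 2) :=
    fun i => by rw [integral_indicator_one (hWm' i)]; exact hmeas i u₂ le_rfl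
  refine (norm_integral_le_of_norm_le
    (integrable_finsetSum _ fun i _ => (hWi i).add (hWi' i)) (Eventually.of_forall hbd)).trans ?_
  rw [integral_finsetSum _ fun i _ => (hWi i).add (hWi' i)]
  calc ∑ i, ∫ v, ((W i).indicator (1 : (ι → ℝ) → ℝ) v + (W' i).indicator 1 v) ∂μ
      ≤ ∑ i : ι, (η * rexp (-u₂ ^ 2 / 2) + η * rexp (-u₂ ^ 2 / 2)) := by
        refine Finset.sum_le_sum fun i _ => ?_
        rw [integral_add (hWi i) (hWi' i)]
        exact add_le_add (hIW i) (hIW' i)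
    _ = _ := by
        rw [Finset.sum_const, Finset.card_univ, nsmul_eq_mul]; ring

end Sandwich

section Comparison

variable {ι : Type*} [Fintype ι] {μ ν : Measure (ι → ℝ)} {S T : ι → ι → ℝ}

lemma GaussCov.map_eval (h : GaussCov μ S) (hS : ∀ i, S i i = 1) (i : ι) :
    μ.map (fun v => v i) = gaussianReal 0 1 := by
  have := h.map_eq (Pi.single i 1)
  simpa [Pi.single_apply, hS] using this

/-- Normal comparison inequality for the joint exceedance counts. -/
lemma GaussCov.abs_countEvent_sub_le [IsProbabilityMeasure μ] [IsProbabilityMeasure ν]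
    (hμ : GaussCov μ S) (hν : GaussCov ν T) (hS : ∀ i, S i i = 1) (hT : ∀ i, T i i = 1)
    {C : ℝ} {e : ι → Bool} {K M : ℕ} {u₁ u₂ η : ℝ}
    (hC : 1 ≤ C) (h1 : ∀ x, |deriv smoothTransition x| ≤ C)
    (h2 : ∀ x, |deriv (deriv smoothTransition) x| ≤ C) (hη : 0 < η)
    (hu : u₂ ≤ u₁) (hu0 : 0 ≤ u₂) {ω : ι → ι → ℝ} {δ : ℝ} (hδ : δ < 1)
    (hωδ : ∀ i j, i ≠ j → ω i j ≤ δ)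
    (hωS : ∀ i j, i ≠ j → |S i j| ≤ ω i j) (hωT : ∀ i j, i ≠ j → |T i j| ≤ ω i j) :
    |(ν (countEvent e K M u₁ u₂)).toReal - (μ (countEvent e K M u₁ u₂)).toReal| ≤
      2 * (∑ i, ∑ j, if i = j then 0 else
        |T i j - S i j| * (4 * C ^ 2 * (C / η) ^ 2 *
          (2 * (u₁ - u₂ + η) ^ 2 / (1 - δ) * rexp (-u₂ ^ 2 / (1 + ω i j))))) +
      4 * Fintype.card ι * (η * rexp (-u₂ ^ 2 / 2)) := by
  obtain ⟨A₀, hA₀⟩ := exists_factor_of_nonneg S hμ.symm hμ.nonneg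
  obtain ⟨B₀, hB₀⟩ := exists_factor_of_nonneg T hν.symm hν.nonneg
  set A : ι → ι ⊕ ι → ℝ := fun i => Sum.elim (A₀ i) 0 with hA
  set B : ι → ι ⊕ ι → ℝ := fun i => Sum.elim 0 (B₀ i) with hB
  have hAA : ∀ i j, ∑ a, A i a * A j a = S i j := fun i j => by simp [hA, hA₀]
  have hBB : ∀ i j, ∑ a, B i a * B j a = T i j := fun i j => by simp [hB, hB₀]
  have hAB : ∀ i j, ∑ a, A i a * B j a = 0 := fun i j => by simp [hA, hB]
  have eμ := eq_map_stdG (μ := μ) A (fun c => by simp_rw [hAA]; exact hμ.map_eq c)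
  have eν := eq_map_stdG (μ := ν) B (fun c => by simp_rw [hBB]; exact hν.map_eq c)
  set F := countTest (fun i => if e i = true then (1 : ℝ) else 0) K M u₁ u₂ η with hF
  have hFm : Measurable F := measurable_countTest _ _ _ _ _ _
  have iμ : ∫ v, F v ∂μ = ∫ h, F (fun i => ∑ a, A i a * h a) ∂stdG (ι ⊕ ι) := by
    rw [eμ, integral_map (measurable_linearForms A).aemeasurable hFm.aestronglyMeasurable]
  have iν : ∫ v, F v ∂ν = ∫ h, F (fun i => ∑ a, B i a * h a) ∂stdG (ι ⊕ ι) := by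
    rw [eν, integral_map (measurable_linearForms B).aemeasurable hFm.aestronglyMeasurable]
  have key := abs_integral_countTest_sub_le (K := K) (M := M) hC h1 h2 hη hu hu0
    (e := fun i => if e i = true then (1 : ℝ) else 0)
    (fun i => by split_ifs <;> simp) hAB (fun i => by rw [hAA, hS]) (fun i => by rw [hBB, hT])
    hδ hωδ (fun i j hij => by rw [hAA]; exact hωS i j hij)
    (fun i j hij => by rw [hBB]; exact hωT i j hij)
  rw [← hF, ← iμ, ← iν] at key
  simp_rw [hAA, hBB] at key
  have sμ := abs_measure_countEvent_sub_le (e := e) (K := K) (M := M) (hμ.map_eval hS) hη hu0 hu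
  have sν := abs_measure_countEvent_sub_le (e := e) (K := K) (M := M) (hν.map_eval hT) hη hu0 hu
  rw [← hF] at sμ sν
  rw [abs_le] at *
  constructor <;> linarith [key.1, key.2, sμ.1, sμ.2, sν.1, sν.2]

end Comparison

section Levels

lemma tendsto_log_natCast : Tendsto (fun n : ℕ => log (n : ℝ)) atTop atTop :=
  tendsto_log_atTop.comp tendsto_natCast_atTop_atTop

lemma tendsto_sqrt_two_log : Tendsto (fun n : ℕ => √(2 * log (n : ℝ))) atTop atTop :=
  tendsto_sqrt_atTop.comp (tendsto_log_natCast.const_mul_atTop two_pos)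

/-- The centering correction of the levels, scaled by `a_n`. -/
noncomputable def levelShift (n : ℕ) : ℝ := (log (log n) + log (4 * π)) / 2

lemma tendsto_log_div_sqrt : Tendsto (fun x : ℝ => log x / √x) atTop (nhds 0) := by
  have := (isLittleO_log_rpow_atTop (show (0 : ℝ) < 1 / 2 by norm_num)).tendsto_div_nhds_zero
  simpa [Real.sqrt_eq_rpow] using this

lemma tendsto_levelShift_div :
    Tendsto (fun n : ℕ => levelShift n / √(2 * log (n : ℝ))) atTop (nhds 0) := by
  have h1 := (tendsto_log_div_sqrt.comp tendsto_log_natCast).div_const (2 * √2)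
  have h2 := (tendsto_sqrt_two_log.inv_tendsto_atTop).const_mul (log (4 * π) / 2)
  have h := h1.add h2
  simp only [zero_div, mul_zero, add_zero] at h
  refine h.congr' ?_
  filter_upwards [tendsto_log_natCast.eventually_gt_atTop 0] with n hn
  have hs : √(log (n : ℝ)) ≠ 0 := (sqrt_pos.2 hn).ne'
  have h2' : √(2 : ℝ) ≠ 0 := by positivity
  simp only [Function.comp_apply, Pi.inv_apply, levelShift]
  rw [sqrt_mul two_pos.le]
  field_simp

lemma un_eq (n : ℕ) (x : ℝ) :
    un n x = √(2 * log n) + (x - levelShift n) / √(2 * log n) := by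
  unfold un levelShift
  rcases eq_or_ne (√(2 * log (n : ℝ))) 0 with h | h
  · simp [h]
  · field_simp; ring

lemma tendsto_sub_levelShift_div {x : ℕ → ℝ} {x₀ : ℝ} (hx : Tendsto x atTop (nhds x₀)) :
    Tendsto (fun n : ℕ => (x n - levelShift n) / √(2 * log (n : ℝ))) atTop (nhds 0) := by
  have h := (hx.mul tendsto_sqrt_two_log.inv_tendsto_atTop).sub tendsto_levelShift_div
  simp only [mul_zero, sub_zero] at h
  refine h.congr fun n => ?_
  simp only [Pi.inv_apply]; ring

lemma tendsto_un {x : ℕ → ℝ} {x₀ : ℝ} (hx : Tendsto x atTop (nhds x₀)) :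
    Tendsto (fun n => un n (x n)) atTop atTop := by
  simp_rw [un_eq]
  exact tendsto_sqrt_two_log.atTop_add (tendsto_sub_levelShift_div hx)

lemma tendsto_un_div {x : ℕ → ℝ} {x₀ : ℝ} (hx : Tendsto x atTop (nhds x₀)) :
    Tendsto (fun n => un n (x n) / √(2 * log (n : ℝ))) atTop (nhds 1) := by
  have h := ((tendsto_sub_levelShift_div hx).mul tendsto_sqrt_two_log.inv_tendsto_atTop).const_add 1
  simp only [mul_zero, add_zero] at h
  refine h.congr' ?_
  filter_upwards [tendsto_sqrt_two_log.eventually_gt_atTop 0] with n hn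
  rw [un_eq, add_div, div_self hn.ne', Pi.inv_apply, div_eq_mul_inv (_ / _)]

lemma exp_neg_sq_un {n : ℕ} (hn : 1 < n) (x : ℝ) :
    rexp (-un n x ^ 2 / 2) = √(2 * π) * rexp (-x) * (√(2 * log n) / n) *
      rexp (-((x - levelShift n) / √(2 * log n)) ^ 2 / 2) := by
  have hL : 0 < log (n : ℝ) := log_pos (by exact_mod_cast hn)
  have hn0 : (0 : ℝ) < n := by positivity
  have ha : 0 < √(2 * log (n : ℝ)) := sqrt_pos.2 (by positivity)
  have ha2 : √(2 * log (n : ℝ)) ^ 2 = 2 * log n := sq_sqrt (by positivity)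
  have e1 : -un n x ^ 2 / 2 = levelShift n + (-x) + (-log n) +
      (-((x - levelShift n) / √(2 * log n)) ^ 2 / 2) := by
    rw [un_eq]
    have : √(2 * log (n : ℝ)) * ((x - levelShift n) / √(2 * log n)) = x - levelShift n := by
      field_simp
    nlinarith [this, ha2]
  have e2 : rexp (levelShift n) = √(2 * π) * √(2 * log n) := by
    rw [← sqrt_mul (by positivity)]
    unfold levelShift
    rw [← log_mul hL.ne' (by positivity), ← log_sqrt (by positivity), exp_log (by positivity)]
    congr 1; ring
  rw [e1, exp_add, exp_add, exp_add, e2, exp_neg (log _), exp_log hn0]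
  ring

lemma tendsto_exp_neg_sq_un {x : ℕ → ℝ} {x₀ : ℝ} (hx : Tendsto x atTop (nhds x₀)) :
    Tendsto (fun n : ℕ => n / √(2 * log (n : ℝ)) * rexp (-un n (x n) ^ 2 / 2)) atTop
      (nhds (√(2 * π) * rexp (-x₀))) := by
  have h1 := (tendsto_sub_levelShift_div hx).pow 2
  have h2 := ((h1.neg).div_const 2).rexp
  have h3 := ((hx.neg).rexp.const_mul √(2 * π)).mul h2
  have e : √(2 * π) * rexp (-x₀) * rexp (-0 ^ 2 / 2) = √(2 * π) * rexp (-x₀) := by simp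
  rw [e] at h3
  refine h3.congr' ?_
  filter_upwards [eventually_gt_atTop 1, tendsto_sqrt_two_log.eventually_gt_atTop 0] with n hn ha
  have hn0 : (0 : ℝ) < n := by positivity
  rw [exp_neg_sq_un hn]
  field_simp

lemma exp_neg_sq_un_le {n : ℕ} (hn : 1 < n) (x : ℝ) :
    rexp (-un n x ^ 2 / 2) ≤ √(2 * π) * rexp (-x) * (√(2 * log n) / n) := by
  rw [exp_neg_sq_un hn]
  refine mul_le_of_le_one_right (by positivity) (exp_le_one_iff.2 ?_)
  have := sq_nonneg ((x - levelShift n) / √(2 * log (n : ℝ)))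
  linarith

end Levels

section Mills

lemma tendsto_gaussianPDFReal_atTop : Tendsto (gaussianPDFReal 0 1) atTop (nhds 0) := by
  have h : Tendsto (fun x : ℝ => rexp (-x)) atTop (nhds 0) := tendsto_exp_neg_atTop_nhds_zero
  refine squeeze_zero' (Eventually.of_forall fun x => gaussianPDFReal_nonneg _ _ _) ?_ h
  filter_upwards [eventually_ge_atTop 2] with x hx
  refine (gaussianPDFReal_le_exp x).trans (exp_le_exp.2 ?_)
  nlinarith

lemma gaussianReal_Ioi_toReal (u : ℝ) :
    (gaussianReal 0 1 (Set.Ioi u)).toReal = ∫ t in Set.Ioi u, gaussianPDFReal 0 1 t := by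
  rw [gaussianReal_apply_eq_integral _ one_ne_zero,
    ENNReal.toReal_ofReal (integral_nonneg fun x => gaussianPDFReal_nonneg _ _ _)]

lemma gaussianReal_Ioi_le {u : ℝ} (hu : 0 < u) :
    (gaussianReal 0 1 (Set.Ioi u)).toReal ≤ gaussianPDFReal 0 1 u / u := by
  have hd : ∀ x ∈ Set.Ici u, HasDerivAt (fun t => -gaussianPDFReal 0 1 t)
      (x * gaussianPDFReal 0 1 x) x := fun x _ =>
    (hasDerivAt_gaussianPDFReal x).fun_neg.congr_deriv (by ring)
  have hpos : ∀ x ∈ Set.Ioi u, 0 ≤ x * gaussianPDFReal 0 1 x := fun x hx =>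
    mul_nonneg (hu.le.trans (le_of_lt hx)) (gaussianPDFReal_nonneg _ _ _)
  have ht : Tendsto (fun t => -gaussianPDFReal 0 1 t) atTop (nhds 0) := by
    simpa using tendsto_gaussianPDFReal_atTop.neg
  have hi := integral_Ioi_of_hasDerivAt_of_nonneg' hd hpos ht
  have hint := integrableOn_Ioi_deriv_of_nonneg' hd hpos ht
  rw [gaussianReal_Ioi_toReal, le_div_iff₀ hu, ← integral_mul_const]
  rw [zero_sub, neg_neg] at hi
  rw [← hi]
  refine setIntegral_mono_on ((integrable_gaussianPDFReal 0 1).integrableOn.mul_const u) hint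
    measurableSet_Ioi fun x hx => ?_
  rw [mul_comm]
  exact mul_le_mul_of_nonneg_right (le_of_lt hx) (gaussianPDFReal_nonneg _ _ _)

lemma le_gaussianReal_Ioi {u : ℝ} (hu : 0 < u) :
    gaussianPDFReal 0 1 u / u ≤ (1 + 1 / u ^ 2) * (gaussianReal 0 1 (Set.Ioi u)).toReal := by
  have hd : ∀ x ∈ Set.Ici u, HasDerivAt (fun t => -(gaussianPDFReal 0 1 t / t))
      ((1 + 1 / x ^ 2) * gaussianPDFReal 0 1 x) x := fun x hx => by
    have hx0 : x ≠ 0 := (hu.trans_le hx).ne'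
    refine ((hasDerivAt_gaussianPDFReal x).div (hasDerivAt_id x) hx0).fun_neg.congr_deriv ?_
    simp only [id]
    field_simp
    ring
  have hpos : ∀ x ∈ Set.Ioi u, 0 ≤ (1 + 1 / x ^ 2) * gaussianPDFReal 0 1 x := fun x hx =>
    mul_nonneg (by positivity) (gaussianPDFReal_nonneg _ _ _)
  have ht : Tendsto (fun t => -(gaussianPDFReal 0 1 t / t)) atTop (nhds 0) := by
    simpa using (tendsto_gaussianPDFReal_atTop.div_atTop tendsto_id).neg
  have hi := integral_Ioi_of_hasDerivAt_of_nonneg' hd hpos ht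
  have hint := integrableOn_Ioi_deriv_of_nonneg' hd hpos ht
  rw [zero_sub, neg_neg] at hi
  rw [gaussianReal_Ioi_toReal, ← hi, ← integral_const_mul]
  refine setIntegral_mono_on hint ((integrable_gaussianPDFReal 0 1).integrableOn.const_mul _)
    measurableSet_Ioi fun x hx => ?_
  have hx : u < x := hx
  have := gaussianPDFReal_nonneg 0 1 x
  gcongr

/-- Expected number of exceedances of the level `u_n(x_n)`. -/
lemma tendsto_mul_gaussianReal_Ioi_un {x : ℕ → ℝ} {x₀ : ℝ} (hx : Tendsto x atTop (nhds x₀)) :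
    Tendsto (fun n : ℕ => n * (gaussianReal 0 1 (Set.Ioi (un n (x n)))).toReal) atTop
      (nhds (rexp (-x₀))) := by
  have hu := tendsto_un hx
  have hup : Tendsto (fun n : ℕ => n * (gaussianPDFReal 0 1 (un n (x n)) / un n (x n))) atTop
      (nhds (rexp (-x₀))) := by
    have h := ((tendsto_exp_neg_sq_un hx).const_mul (√(2 * π))⁻¹).div (tendsto_un_div hx) one_ne_zero
    rw [div_one, inv_mul_cancel_left₀ (by positivity)] at h
    refine h.congr' ?_
    filter_upwards [hu.eventually_gt_atTop 0, tendsto_sqrt_two_log.eventually_gt_atTop 0]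
      with n hn ha
    simp only [gaussianPDFReal_def, Pi.div_apply, NNReal.coe_one, mul_one, sub_zero]
    field_simp
  have hlow : Tendsto (fun n : ℕ => n * (gaussianPDFReal 0 1 (un n (x n)) / un n (x n)) /
      (1 + 1 / un n (x n) ^ 2)) atTop (nhds (rexp (-x₀))) := by
    have h1 : Tendsto (fun n => 1 + 1 / un n (x n) ^ 2) atTop (nhds 1) := by
      have := (tendsto_const_nhds (x := (1 : ℝ))).div_atTop
        ((tendsto_pow_atTop (two_ne_zero)).comp hu)
      simpa using this.const_add 1
    have h := hup.div h1 one_ne_zero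
    rwa [div_one] at h
  refine tendsto_of_tendsto_of_tendsto_of_le_of_le' hlow hup ?_ ?_
  · filter_upwards [hu.eventually_gt_atTop 0] with n hn
    rw [div_le_iff₀ (by positivity), mul_assoc]
    refine mul_le_mul_of_nonneg_left ?_ (by positivity)
    rw [mul_comm]
    exact le_gaussianReal_Ioi hn
  · filter_upwards [hu.eventually_gt_atTop 0] with n hn
    exact mul_le_mul_of_nonneg_left (gaussianReal_Ioi_le hn) (by positivity)

/-- Conditional exceedance probability in the equicorrelated model. -/
noncomputable def condTail (γ : ℝ) (n : ℕ) (x z : ℝ) : ℝ :=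
  (gaussianReal 0 1 (Set.Ioi ((un n x - √(γ / log n) * z) / √(1 - γ / log n)))).toReal

lemma tendsto_mul_condTail (γ x z : ℝ) :
    Tendsto (fun n : ℕ => n * condTail γ n x z) atTop (nhds (g γ x z)) := by
  set ρ : ℕ → ℝ := fun n => γ / log n with hρ
  have hρ0 : Tendsto ρ atTop (nhds 0) := tendsto_const_nhds.div_atTop tendsto_log_natCast
  have hs : Tendsto (fun n => √(1 - ρ n)) atTop (nhds 1) := by
    simpa using (hρ0.const_sub 1).sqrt
  set x' : ℕ → ℝ := fun n => (x - √(2 * γ) * z) / √(1 - ρ n) +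
    γ * (2 - levelShift n / log n) / (√(1 - ρ n) * (1 + √(1 - ρ n))) with hx'
  have hsl : Tendsto (fun n : ℕ => levelShift n / log (n : ℝ)) atTop (nhds 0) := by
    have h := (tendsto_levelShift_div.mul tendsto_sqrt_two_log.inv_tendsto_atTop).const_mul 2
    simp only [mul_zero] at h
    refine h.congr' ?_
    filter_upwards [tendsto_log_natCast.eventually_gt_atTop 0] with n hn
    have ha2 : √(2 * log (n : ℝ)) * √(2 * log n) = 2 * log n := mul_self_sqrt (by positivity)
    rw [Pi.inv_apply, ← div_eq_mul_inv, div_div, ha2]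
    field_simp
  have hlim : Tendsto x' atTop (nhds (x + γ - √(2 * γ) * z)) := by
    have h1 := (tendsto_const_nhds (x := x - √(2 * γ) * z)).div hs one_ne_zero
    have h2 := ((hsl.const_sub 2).const_mul γ).div (hs.mul (hs.const_add 1)) (by norm_num)
    have h := h1.add h2
    have e : (x - √(2 * γ) * z) / 1 + γ * (2 - 0) / (1 * (1 + 1)) = x + γ - √(2 * γ) * z := by ring
    rw [e] at h
    exact h
  have hmain := tendsto_mul_gaussianReal_Ioi_un hlim
  have eg : rexp (-(x + γ - √(2 * γ) * z)) = g γ x z := by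
    unfold g; congr 1; ring
  rw [eg] at hmain
  refine hmain.congr' ?_
  filter_upwards [tendsto_log_natCast.eventually_gt_atTop 0,
    hρ0.eventually_lt_const (show (0 : ℝ) < 1 by norm_num)] with n hn hρ1
  unfold condTail
  congr 4
  have hq : 0 < √(1 - ρ n) := sqrt_pos.2 (by linarith)
  have hq2 : √(1 - ρ n) ^ 2 = 1 - γ / log n := sq_sqrt (by linarith)
  have ha : 0 < √(2 * log (n : ℝ)) := sqrt_pos.2 (by positivity)
  have ha2 : √(2 * log (n : ℝ)) ^ 2 = 2 * log n := sq_sqrt (by positivity)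
  have hag : √(2 * γ) = √(2 * log (n : ℝ)) * √(γ / log n) := by
    rw [← sqrt_mul (by positivity)]; congr 1; field_simp
  change un n (x' n) = (un n x - √(γ / log n) * z) / √(1 - ρ n)
  rw [un_eq, un_eq, hx']
  simp only
  rw [hag]
  set q := √(1 - ρ n)
  set a := √(2 * log (n : ℝ))
  set r := √(γ / log (n : ℝ))
  set c := levelShift n
  have hgam : γ = (1 - q ^ 2) * log n := by rw [hq2]; field_simp; ring
  have hlog : log (n : ℝ) = a ^ 2 / 2 := by linarith
  rw [hgam, hlog]
  field_simp
  ring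
end Mills

/-- Probability of `t` unmarked exceedances, `j` high and `l` intermediate marked exceedances among
`N₀` unmarked and `N₁` marked independent trials. -/
noncomputable def trialProb (N₀ N₁ : ℕ) (p₁ p₂ : ℝ) (t j l : ℕ) : ℝ :=
  (N₀.choose t * p₂ ^ t) * ((N₁.choose j * p₁ ^ j) * ((N₁ - j).choose l * (p₂ - p₁) ^ l)) *
    (1 - p₂) ^ (N₀ + N₁ - (t + j + l))

section Independent

variable {ι : Type*} [Fintype ι] {e : ι → Bool} {K M : ℕ} {u₁ u₂ : ℝ}

lemma stdG_cell_toReal (hu : u₂ ≤ u₁) {T₀ T₁ T₂ : Finset ι} (h₀ : ∀ i ∈ T₀, e i = false)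
    (h₁ : ∀ i ∈ T₁, e i = true) (h₂ : ∀ i ∈ T₂, e i = true ∧ i ∉ T₁) :
    (stdG ι {h | (Finset.univ.filter fun i => e i = false ∧ u₂ < h i) = T₀ ∧
      (Finset.univ.filter fun i => e i = true ∧ u₁ < h i) = T₁ ∧
      (Finset.univ.filter fun i => e i = true ∧ u₂ < h i ∧ ¬ u₁ < h i) = T₂}).toReal =
    (gaussianReal 0 1 (Set.Ioi u₂)).toReal ^ T₀.card *
      ((gaussianReal 0 1 (Set.Ioi u₁)).toReal ^ T₁.card *
      ((gaussianReal 0 1 (Set.Ioi u₂)).toReal - (gaussianReal 0 1 (Set.Ioi u₁)).toReal) ^ T₂.card) *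
      (1 - (gaussianReal 0 1 (Set.Ioi u₂)).toReal) ^
        (Fintype.card ι - (T₀.card + T₁.card + T₂.card)) := by
  have hset : {h : ι → ℝ | (Finset.univ.filter fun i => e i = false ∧ u₂ < h i) = T₀ ∧
      (Finset.univ.filter fun i => e i = true ∧ u₁ < h i) = T₁ ∧
      (Finset.univ.filter fun i => e i = true ∧ u₂ < h i ∧ ¬ u₁ < h i) = T₂} =
      Set.pi Set.univ fun i => if i ∈ T₀ then Set.Ioi u₂ else if i ∈ T₁ then Set.Ioi u₁ else
        if i ∈ T₂ then Set.Ioc u₂ u₁ else Set.Iic u₂ := by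
    ext h
    simp only [Set.mem_ofPred_eq, Finset.ext_iff, Finset.mem_filter, Finset.mem_univ, true_and,
      Set.mem_pi, Set.mem_univ, forall_true_left, ← forall_and]
    refine forall_congr' fun i => ?_
    have a₀ := h₀ i
    have a₁ := h₁ i
    have a₂ := h₂ i
    have a₃ : u₁ < h i → u₂ < h i := fun hh => hu.trans_lt hh
    by_cases b₀ : i ∈ T₀ <;> by_cases b₁ : i ∈ T₁ <;> by_cases b₂ : i ∈ T₂ <;>
      by_cases c₁ : u₁ < h i <;> by_cases c₂ : u₂ < h i <;>
      cases he : e i <;> simp_all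
  rw [hset, stdG, Measure.pi_pi, ENNReal.toReal_prod]
  have hIoc : (gaussianReal 0 1 (Set.Ioc u₂ u₁)).toReal =
      (gaussianReal 0 1 (Set.Ioi u₂)).toReal - (gaussianReal 0 1 (Set.Ioi u₁)).toReal := by
    have : Set.Ioc u₂ u₁ = Set.Ioi u₂ \ Set.Ioi u₁ := by ext; simp
    rw [this]
    exact measureReal_sdiff (Set.Ioi_subset_Ioi hu) measurableSet_Ioi
  have hIic : (gaussianReal 0 1 (Set.Iic u₂)).toReal =
      1 - (gaussianReal 0 1 (Set.Ioi u₂)).toReal := by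
    rw [← Set.compl_Ioi]
    exact probReal_compl_eq_one_sub measurableSet_Ioi
  have hcell : ∀ i, (gaussianReal 0 1 (if i ∈ T₀ then Set.Ioi u₂ else if i ∈ T₁ then Set.Ioi u₁ else
        if i ∈ T₂ then Set.Ioc u₂ u₁ else Set.Iic u₂)).toReal =
      (if i ∈ T₀ then (gaussianReal 0 1 (Set.Ioi u₂)).toReal else 1) *
      ((if i ∈ T₁ then (gaussianReal 0 1 (Set.Ioi u₁)).toReal else 1) *
      (if i ∈ T₂ then ((gaussianReal 0 1 (Set.Ioi u₂)).toReal -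
        (gaussianReal 0 1 (Set.Ioi u₁)).toReal) else 1)) *
      (if i ∈ (T₀ ∪ T₁ ∪ T₂)ᶜ then (1 - (gaussianReal 0 1 (Set.Ioi u₂)).toReal) else 1) := by
    intro i
    have a₀ := h₀ i
    have a₁ := h₁ i
    have a₂ := h₂ i
    rw [← hIoc, ← hIic]
    by_cases b₀ : i ∈ T₀ <;> by_cases b₁ : i ∈ T₁ <;> by_cases b₂ : i ∈ T₂ <;>
      simp_all
  have hcard : (T₀ ∪ T₁ ∪ T₂)ᶜ.card = Fintype.card ι - (T₀.card + T₁.card + T₂.card) := by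
    rw [Finset.card_compl, Finset.card_union_of_disjoint, Finset.card_union_of_disjoint]
    · exact Finset.disjoint_left.2 fun i hi hi' => by
        simpa [h₀ i hi] using h₁ i hi'
    · refine Finset.disjoint_left.2 fun i hi hi' => ?_
      rcases Finset.mem_union.1 hi with hi | hi
      · have := h₀ i hi; rw [(h₂ i hi').1] at this; simp at this
      · exact (h₂ i hi').2 hi
  rw [Finset.prod_congr rfl fun i _ => hcell i]
  simp only [Finset.prod_mul_distrib, Finset.prod_ite_mem, Finset.univ_inter, Finset.prod_const,
    hcard]

lemma stdG_counts_toReal (hu : u₂ ≤ u₁) (t j l : ℕ) :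
    (stdG ι {h | (Finset.univ.filter fun i => e i = false ∧ u₂ < h i).card = t ∧
      (Finset.univ.filter fun i => e i = true ∧ u₁ < h i).card = j ∧
      (Finset.univ.filter fun i => e i = true ∧ u₂ < h i ∧ ¬ u₁ < h i).card = l}).toReal =
    trialProb (Finset.univ.filter fun i => e i = false).card
      (Finset.univ.filter fun i => e i = true).card (gaussianReal 0 1 (Set.Ioi u₁)).toReal
      (gaussianReal 0 1 (Set.Ioi u₂)).toReal t j l := by
  set U := Finset.univ.filter fun i => e i = false with hU
  set V := Finset.univ.filter fun i => e i = true with hV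
  set A : (ι → ℝ) → Finset ι := fun h => Finset.univ.filter fun i => e i = false ∧ u₂ < h i with hA
  set B : (ι → ℝ) → Finset ι := fun h => Finset.univ.filter fun i => e i = true ∧ u₁ < h i with hB
  set D : (ι → ℝ) → Finset ι := fun h =>
    Finset.univ.filter fun i => e i = true ∧ u₂ < h i ∧ ¬ u₁ < h i with hD
  have hmeas : ∀ (Q : (ι → ℝ) → ι → Prop) [∀ h i, Decidable (Q h i)],
      (∀ i, MeasurableSet {h | Q h i}) → ∀ T : Finset ι,
      MeasurableSet {h | (Finset.univ.filter fun i => Q h i) = T} := by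
    intro Q _ hQ T
    have : {h | (Finset.univ.filter fun i => Q h i) = T} = ⋂ i, {h | Q h i ↔ i ∈ T} := by
      ext h; simp [Finset.ext_iff]
    rw [this]
    refine MeasurableSet.iInter fun i => ?_
    by_cases hi : i ∈ T
    · simpa [hi] using hQ i
    · have : {h | Q h i ↔ i ∈ T} = {h | Q h i}ᶜ := by ext; simp [hi]
      rw [this]
      exact (hQ i).compl
  have hlt : ∀ (i : ι) (u : ℝ), MeasurableSet {h : ι → ℝ | u < h i} := fun i u =>
    measurableSet_lt measurable_const (measurable_pi_apply i)
  have hm : ∀ T₀ T₁ T₂, MeasurableSet {h | A h = T₀ ∧ B h = T₁ ∧ D h = T₂} := fun T₀ T₁ T₂ =>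
    (hmeas (fun h i => e i = false ∧ u₂ < h i)
      (fun i => (MeasurableSet.const _).inter (hlt i u₂)) T₀).inter
      ((hmeas (fun h i => e i = true ∧ u₁ < h i)
        (fun i => (MeasurableSet.const _).inter (hlt i u₁)) T₁).inter
        (hmeas (fun h i => e i = true ∧ u₂ < h i ∧ ¬ u₁ < h i)
          (fun i => (MeasurableSet.const _).inter ((hlt i u₂).inter (hlt i u₁).compl)) T₂))
  have hset : {h | (A h).card = t ∧ (B h).card = j ∧ (D h).card = l} =
      ⋃ T₀ ∈ U.powersetCard t, ⋃ T₁ ∈ V.powersetCard j, ⋃ T₂ ∈ (V \ T₁).powersetCard l,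
        {h | A h = T₀ ∧ B h = T₁ ∧ D h = T₂} := by
    ext h
    simp only [Set.mem_ofPred_eq, Set.mem_iUnion, Finset.mem_powersetCard, exists_prop]
    constructor
    · rintro ⟨h0, h1, h2⟩
      refine ⟨A h, ⟨?_, h0⟩, B h, ⟨?_, h1⟩, D h, ⟨?_, h2⟩, rfl, rfl, rfl⟩
      · intro i; simp only [hA, hU, Finset.mem_filter]; tauto
      · intro i; simp only [hB, hV, Finset.mem_filter]; tauto
      · intro i; simp only [hB, hD, hV, Finset.mem_filter, Finset.mem_sdiff]; tauto
    · rintro ⟨T₀, ⟨-, h0⟩, T₁, ⟨-, h1⟩, T₂, ⟨-, h2⟩, rfl, rfl, rfl⟩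
      exact ⟨h0, h1, h2⟩
  change (stdG ι {h | (A h).card = t ∧ (B h).card = j ∧ (D h).card = l}).toReal = _
  rw [hset, ← Measure.real_def, measureReal_biUnion_finset (h := fun _ _ => measure_ne_top _ _)]
  rotate_left
  · intro T _ T' _ hne
    refine Set.disjoint_left.2 fun h hh hh' => hne ?_
    simp only [Set.mem_iUnion, Set.mem_ofPred_eq] at hh hh'
    obtain ⟨_, _, _, _, h1, _⟩ := hh
    obtain ⟨_, _, _, _, h2, _⟩ := hh'
    exact h1.symm.trans h2
  · exact fun T₀ _ => Finset.measurableSet_biUnion _ fun T₁ _ =>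
      Finset.measurableSet_biUnion _ fun T₂ _ => hm _ _ _
  have inner : ∀ T₀ ∈ U.powersetCard t, ∀ T₁ ∈ V.powersetCard j,
      (stdG ι).real (⋃ T₂ ∈ (V \ T₁).powersetCard l, {h | A h = T₀ ∧ B h = T₁ ∧ D h = T₂}) =
      ((V.card - j).choose l : ℝ) * ((gaussianReal 0 1 (Set.Ioi u₂)).toReal ^ t *
      ((gaussianReal 0 1 (Set.Ioi u₁)).toReal ^ j *
      ((gaussianReal 0 1 (Set.Ioi u₂)).toReal - (gaussianReal 0 1 (Set.Ioi u₁)).toReal) ^ l) *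
      (1 - (gaussianReal 0 1 (Set.Ioi u₂)).toReal) ^
        (Fintype.card ι - (t + j + l))) := by
    intro T₀ hT₀ T₁ hT₁
    rw [Finset.mem_powersetCard] at hT₀ hT₁
    rw [measureReal_biUnion_finset (h := fun _ _ => measure_ne_top _ _)]
    · rw [← hT₁.2, ← Finset.card_sdiff_of_subset hT₁.1, ← Finset.card_powersetCard, ← nsmul_eq_mul,
        ← Finset.sum_const]
      refine Finset.sum_congr rfl fun T₂ hT₂ => ?_
      rw [Finset.mem_powersetCard] at hT₂
      rw [← hT₀.2, ← hT₂.2]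
      refine stdG_cell_toReal hu (fun i hi => ?_) (fun i hi => ?_) (fun i hi => ?_)
      · simpa [hU] using hT₀.1 hi
      · simpa [hV] using hT₁.1 hi
      · simpa [hV] using hT₂.1 hi
    · intro T _ T' _ hne
      refine Set.disjoint_left.2 fun h hh hh' => hne ?_
      exact hh.2.2.symm.trans hh'.2.2
    · exact fun T₂ _ => hm _ _ _
  have mid : ∀ T₀ ∈ U.powersetCard t,
      (stdG ι).real (⋃ T₁ ∈ V.powersetCard j, ⋃ T₂ ∈ (V \ T₁).powersetCard l,
        {h | A h = T₀ ∧ B h = T₁ ∧ D h = T₂}) =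
      (V.card.choose j : ℝ) * (((V.card - j).choose l : ℝ) *
      ((gaussianReal 0 1 (Set.Ioi u₂)).toReal ^ t *
      ((gaussianReal 0 1 (Set.Ioi u₁)).toReal ^ j *
      ((gaussianReal 0 1 (Set.Ioi u₂)).toReal - (gaussianReal 0 1 (Set.Ioi u₁)).toReal) ^ l) *
      (1 - (gaussianReal 0 1 (Set.Ioi u₂)).toReal) ^
        (Fintype.card ι - (t + j + l)))) := by
    intro T₀ hT₀
    rw [measureReal_biUnion_finset (h := fun _ _ => measure_ne_top _ _), Finset.sum_congr rfl (inner T₀ hT₀), Finset.sum_const,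
      Finset.card_powersetCard, nsmul_eq_mul]
    · intro T _ T' _ hne
      refine Set.disjoint_left.2 fun h hh hh' => hne ?_
      simp only [Set.mem_iUnion, Set.mem_ofPred_eq] at hh hh'
      obtain ⟨_, _, _, h1, _⟩ := hh
      obtain ⟨_, _, _, h2, _⟩ := hh'
      exact h1.symm.trans h2
    · exact fun T₁ _ => Finset.measurableSet_biUnion _ fun T₂ _ => hm _ _ _
  rw [Finset.sum_congr rfl mid, Finset.sum_const, Finset.card_powersetCard, nsmul_eq_mul]
  have hUV : Fintype.card ι = U.card + V.card := by
    have := Finset.card_filter_add_card_filter_not (s := (Finset.univ : Finset ι))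
      (fun i => e i = false)
    simp only [Bool.not_eq_false, Finset.card_univ] at this
    exact this.symm
  rw [hUV, trialProb]
  ring

/-- Exact distribution of the exceedance counts of an independent sample. -/
lemma stdG_countEvent_toReal (hu : u₂ ≤ u₁) :
    (stdG ι (countEvent e K M u₁ u₂)).toReal =
      ∑ t ∈ Finset.range (M + 1), ∑ i ∈ Finset.range (M + 1 - t), ∑ j ∈ Finset.range (min i K + 1),
        trialProb (Finset.univ.filter fun i => e i = false).card
          (Finset.univ.filter fun i => e i = true).card (gaussianReal 0 1 (Set.Ioi u₁)).toReal
          (gaussianReal 0 1 (Set.Ioi u₂)).toReal t j (i - j) := by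
  set A : (ι → ℝ) → ℕ := fun h => (Finset.univ.filter fun i => e i = false ∧ u₂ < h i).card with hA
  set B : (ι → ℝ) → ℕ := fun h => (Finset.univ.filter fun i => e i = true ∧ u₁ < h i).card with hB
  set D : (ι → ℝ) → ℕ := fun h =>
    (Finset.univ.filter fun i => e i = true ∧ u₂ < h i ∧ ¬ u₁ < h i).card with hD
  have hcount : ∀ (Q : (ι → ℝ) → ι → Prop) [∀ h i, Decidable (Q h i)],
      (∀ i, MeasurableSet {h | Q h i}) →
      Measurable fun h => (Finset.univ.filter fun i => Q h i).card := by
    intro Q _ hQ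
    simp_rw [Finset.card_filter]
    exact Finset.measurable_fun_sum _ fun i _ => Measurable.ite (hQ i)
      measurable_const measurable_const
  have hlt : ∀ (i : ι) (u : ℝ), MeasurableSet {h : ι → ℝ | u < h i} := fun i u =>
    measurableSet_lt measurable_const (measurable_pi_apply i)
  have hm : ∀ t j l, MeasurableSet {h | A h = t ∧ B h = j ∧ D h = l} := fun t j l =>
    (hcount (fun h i => e i = false ∧ u₂ < h i)
      (fun i => (MeasurableSet.const _).inter (hlt i u₂)) (measurableSet_singleton t)).inter
      ((hcount (fun h i => e i = true ∧ u₁ < h i)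
        (fun i => (MeasurableSet.const _).inter (hlt i u₁))
        (measurableSet_singleton j)).inter
        (hcount (fun h i => e i = true ∧ u₂ < h i ∧ ¬ u₁ < h i)
          (fun i => (MeasurableSet.const _).inter ((hlt i u₂).inter (hlt i u₁).compl)) (measurableSet_singleton l)))
  have hset : countEvent e K M u₁ u₂ = {h | B h ≤ K ∧ A h + (B h + D h) ≤ M} := by
    ext h
    have e1 : (Finset.univ.filter fun i => u₁ < h i ∧ e i = true).card = B h := by
      simp only [hB, and_comm]
    have e2 : (Finset.univ.filter fun i => u₂ < h i).card = A h + (B h + D h) := by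
      simp only [hA, hB, hD, Finset.card_filter, ← Finset.sum_add_distrib]
      refine Finset.sum_congr rfl fun i _ => ?_
      have a₃ : u₁ < h i → u₂ < h i := fun hh => hu.trans_lt hh
      by_cases c₁ : u₁ < h i <;> by_cases c₂ : u₂ < h i <;> cases he : e i <;> simp_all
    unfold countEvent
    rw [Set.mem_ofPred_eq, Set.mem_ofPred_eq, e1, e2]
  have hind : ∀ h, (countEvent e K M u₁ u₂).indicator (1 : (ι → ℝ) → ℝ) h =
      ∑ t ∈ Finset.range (M + 1), ∑ i ∈ Finset.range (M + 1 - t), ∑ j ∈ Finset.range (min i K + 1),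
        {h | A h = t ∧ B h = j ∧ D h = i - j}.indicator (1 : (ι → ℝ) → ℝ) h := by
    intro h
    have : ∀ t, ∀ i, ∀ j ∈ Finset.range (min i K + 1),
        {h | A h = t ∧ B h = j ∧ D h = i - j}.indicator (1 : (ι → ℝ) → ℝ) h =
        if B h = j then (if B h + D h = i then (if A h = t then 1 else 0) else 0) else 0 := by
      intro t i j hj
      rw [Finset.mem_range] at hj
      rw [Set.indicator_apply]
      by_cases a : A h = t <;> by_cases b : B h = j <;> by_cases c : D h = i - j
      all_goals simp only [Set.mem_ofPred_eq, a, b, c, and_true, and_false,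
        if_true, if_false, Pi.one_apply, ite_self]
      · rw [if_pos (by omega)]
      · rw [if_neg (by omega)]
    rw [Finset.sum_congr rfl fun t _ => Finset.sum_congr rfl fun i _ =>
      Finset.sum_congr rfl (this t i)]
    have h2 : ∀ t i, (∑ j ∈ Finset.range (min i K + 1), if B h = j then
        (if B h + D h = i then (if A h = t then (1 : ℝ) else 0) else 0) else 0) =
        if B h + D h = i then (if B h ≤ K then (if A h = t then 1 else 0) else 0) else 0 := by
      intro t i
      rw [Finset.sum_ite_eq]
      by_cases hi : B h + D h = i
      · simp only [hi, if_true, Finset.mem_range]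
        have : (B h < min i K + 1) ↔ B h ≤ K := by omega
        simp only [this]
      · simp [hi]
    have h3 : ∀ t ∈ Finset.range (M + 1), (∑ i ∈ Finset.range (M + 1 - t), if B h + D h = i then
        (if B h ≤ K then (if A h = t then (1 : ℝ) else 0) else 0) else 0) =
        if A h = t then (if B h ≤ K ∧ A h + (B h + D h) ≤ M then 1 else 0) else 0 := by
      intro t ht
      rw [Finset.mem_range] at ht
      rw [Finset.sum_ite_eq]
      by_cases hA' : A h = t <;> by_cases hB' : B h ≤ K <;>
        simp only [hA', hB', if_true, if_false, Finset.mem_range, true_and, false_and, ite_self]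
      have : B h + D h < M + 1 - t ↔ t + (B h + D h) ≤ M := by omega
      simp only [this]
    simp only [h2]
    rw [Finset.sum_congr rfl h3, Finset.sum_ite_eq, hset, Set.indicator_apply]
    simp only [Finset.mem_range, Set.mem_ofPred_eq, Pi.one_apply]
    by_cases hh : B h ≤ K ∧ A h + (B h + D h) ≤ M
    · rw [if_pos hh, if_pos (by omega)]
    · rw [if_neg hh, ite_self]
  have hI : ∀ t j l, Integrable
      ({h | A h = t ∧ B h = j ∧ D h = l}.indicator (1 : (ι → ℝ) → ℝ)) (stdG ι) := fun t j l =>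
    (integrable_const (1 : ℝ)).indicator (hm t j l)
  have : (stdG ι (countEvent e K M u₁ u₂)).toReal =
      ∫ h, (countEvent e K M u₁ u₂).indicator 1 h ∂stdG ι := by
    rw [integral_indicator_one measurableSet_countEvent]; rfl
  rw [this, integral_congr_ae (Eventually.of_forall hind), integral_finsetSum]
  swap
  · exact fun t _ => integrable_finsetSum _ fun i _ => integrable_finsetSum _ fun j _ => hI _ _ _
  refine Finset.sum_congr rfl fun t _ => ?_
  rw [integral_finsetSum]
  swap
  · exact fun i _ => integrable_finsetSum _ fun j _ => hI _ _ _
  refine Finset.sum_congr rfl fun i _ => ?_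
  rw [integral_finsetSum]
  swap
  · exact fun j _ => hI _ _ _
  refine Finset.sum_congr rfl fun j _ => ?_
  rw [integral_indicator_one (hm _ _ _)]
  exact stdG_counts_toReal hu _ _ _

end Independent

/-- The integrand of the limit law. -/
noncomputable def poissonTerm (ℓ g₁ g₂ : ℝ) (t j l : ℕ) : ℝ :=
  ((1 - ℓ) * g₂) ^ t / (Nat.factorial t : ℝ) * rexp (-g₂) *
    ((ℓ * g₁) ^ j / (Nat.factorial j : ℝ) * ((ℓ * (g₂ - g₁)) ^ l / (Nat.factorial l : ℝ)))

section PoissonLimit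

lemma tendsto_natSub_mul {F : Filter ℕ} {N : ℕ → ℕ} {q : ℕ → ℝ} {c : ℝ}
    (h : Tendsto (fun n => N n * q n) F (nhds c)) (hq : Tendsto q F (nhds 0)) (i : ℕ) :
    Tendsto (fun n => ((N n - i : ℕ) : ℝ) * q n) F (nhds c) := by
  have h1 : Tendsto (fun n => ((N n : ℝ) - ((N n - i : ℕ) : ℝ)) * q n) F (nhds 0) := by
    refine squeeze_zero_norm (a := fun n => i * |q n|) (fun n => ?_)
      (by simpa using hq.abs.const_mul (i : ℝ))
    rw [norm_mul, Real.norm_eq_abs, Real.norm_eq_abs]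
    refine mul_le_mul_of_nonneg_right ?_ (abs_nonneg _)
    have a : ((N n - i : ℕ) : ℝ) ≤ N n := by exact_mod_cast Nat.sub_le _ _
    have b : (N n : ℝ) ≤ ((N n - i : ℕ) : ℝ) + i := by
      exact_mod_cast (by omega : N n ≤ N n - i + i)
    rw [abs_le]
    constructor <;> linarith [Nat.cast_nonneg (α := ℝ) i]
  have := h.sub h1
  rw [sub_zero] at this
  exact this.congr fun n => by ring

lemma tendsto_choose_mul_pow {F : Filter ℕ} {N : ℕ → ℕ} {q : ℕ → ℝ} {c : ℝ}
    (h : Tendsto (fun n => N n * q n) F (nhds c)) (hq : Tendsto q F (nhds 0)) (t : ℕ) :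
    Tendsto (fun n => ((N n).choose t : ℝ) * q n ^ t) F
      (nhds (c ^ t / (Nat.factorial t : ℝ))) := by
  have h1 : Tendsto (fun n => ∏ i ∈ Finset.range t, ((N n - i : ℕ) : ℝ) * q n) F
      (nhds (∏ _i ∈ Finset.range t, c)) :=
    tendsto_finsetProd _ fun i _ => tendsto_natSub_mul h hq i
  rw [Finset.prod_const, Finset.card_range] at h1
  refine (h1.div_const _).congr fun n => ?_
  rw [Finset.prod_mul_distrib, Finset.prod_const, Finset.card_range, ← Nat.cast_prod,
    ← Nat.descFactorial_eq_prod_range, Nat.descFactorial_eq_factorial_mul_choose, Nat.cast_mul]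
  have := Nat.factorial_ne_zero t
  field_simp

lemma tendsto_trialProb {F : Filter ℕ} (hF : F ≤ atTop) {N₀ N₁ : ℕ → ℕ} {p₁ p₂ : ℕ → ℝ} {ℓ g₁ g₂ : ℝ}
    (hN : ∀ n, N₀ n + N₁ n = n) (hℓ : Tendsto (fun n => (N₁ n : ℝ) / n) F (nhds ℓ))
    (h₁ : Tendsto (fun n => n * p₁ n) atTop (nhds g₁))
    (h₂ : Tendsto (fun n => n * p₂ n) atTop (nhds g₂)) (t j l : ℕ) :
    Tendsto (fun n => trialProb (N₀ n) (N₁ n) (p₁ n) (p₂ n) t j l) F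
      (nhds (poissonTerm ℓ g₁ g₂ t j l)) := by
  have hz : ∀ {p : ℕ → ℝ} {c : ℝ}, Tendsto (fun n => n * p n) atTop (nhds c) →
      Tendsto p atTop (nhds 0) := by
    intro p c h
    have := h.mul (tendsto_inv_atTop_zero.comp (tendsto_natCast_atTop_atTop (R := ℝ)))
    rw [mul_zero] at this
    refine this.congr' ?_
    filter_upwards [eventually_gt_atTop 0] with n hn
    simp only [Function.comp_apply]
    field_simp
  have hN1 : ∀ {p : ℕ → ℝ} {c : ℝ}, Tendsto (fun n => n * p n) atTop (nhds c) →
      Tendsto (fun n => N₁ n * p n) F (nhds (ℓ * c)) := by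
    intro p c h
    refine (hℓ.mul (h.mono_left hF)).congr' ?_
    filter_upwards [hF (eventually_gt_atTop 0)] with n hn
    field_simp
  have hN0 : Tendsto (fun n => N₀ n * p₂ n) F (nhds ((1 - ℓ) * g₂)) := by
    have := (h₂.mono_left hF).sub (hN1 h₂)
    rw [← one_sub_mul] at this
    refine this.congr fun n => ?_
    have : (N₀ n : ℝ) + N₁ n = n := by exact_mod_cast hN n
    rw [← this]; ring
  have hd : Tendsto (fun n => n * (p₂ n - p₁ n)) atTop (nhds (g₂ - g₁)) := by
    simpa [mul_sub] using h₂.sub h₁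
  have c0 := tendsto_choose_mul_pow hN0 ((hz h₂).mono_left hF) t
  have c1 := tendsto_choose_mul_pow (hN1 h₁) ((hz h₁).mono_left hF) j
  have c2 := tendsto_choose_mul_pow (tendsto_natSub_mul (hN1 hd) ((hz hd).mono_left hF) j)
    ((hz hd).mono_left hF) l
  have hexp : Tendsto (fun n => (1 - p₂ n) ^ (N₀ n + N₁ n - (t + j + l))) atTop
      (nhds (rexp (-g₂))) := by
    have a : Tendsto (fun n : ℕ => (1 + -p₂ n) ^ n) atTop (nhds (rexp (-g₂))) :=
      Real.tendsto_one_add_pow_exp_of_tendsto (by simpa using h₂.neg)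
    have b : Tendsto (fun n => (1 - p₂ n) ^ (t + j + l)) atTop (nhds 1) := by
      simpa using ((hz h₂).const_sub 1).pow (t + j + l)
    have := a.div b one_ne_zero
    rw [div_one] at this
    refine this.congr' ?_
    filter_upwards [eventually_ge_atTop (t + j + l), (hz h₂).eventually_lt_const one_pos]
      with n hn hp
    rw [hN, Pi.div_apply, ← sub_eq_add_neg, div_eq_iff (pow_pos (by linarith) _).ne', ← pow_add,
      Nat.sub_add_cancel hn]
  have := (c0.mul (c1.mul c2)).mul (hexp.mono_left hF)
  unfold trialProb poissonTerm
  convert this using 2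
  ring

end PoissonLimit

section Equicorrelated

lemma measurable_equiMap {ι : Type*} (ρ : ℝ) :
    Measurable fun (p : ℝ × (ι → ℝ)) (i : ι) => √(1 - ρ) * p.2 i + √ρ * p.1 := by
  fun_prop

variable {ι : Type*} [Fintype ι]

/-- The equicorrelated standard Gaussian law. -/
noncomputable def equiLaw (ι : Type*) [Fintype ι] (ρ : ℝ) : Measure (ι → ℝ) :=
  ((gaussianReal 0 1).prod (stdG ι)).map fun p i => √(1 - ρ) * p.2 i + √ρ * p.1

instance equiLaw.isProbabilityMeasure (ρ : ℝ) : IsProbabilityMeasure (equiLaw ι ρ) :=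
  Measure.isProbabilityMeasure_map (measurable_equiMap ρ).aemeasurable

lemma sum_equi_cov (ρ : ℝ) (c : ι → ℝ) :
    ∑ i, ∑ j, c i * c j * (if i = j then 1 else ρ) =
      (1 - ρ) * ∑ i, c i ^ 2 + ρ * (∑ i, c i) ^ 2 := by
  have : ∀ i j, c i * c j * (if i = j then 1 else ρ) =
      (1 - ρ) * (if i = j then c i * c j else 0) + ρ * (c i * c j) := by
    intro i j; split_ifs <;> ring
  rw [sq (∑ i, c i), Finset.sum_mul_sum]
  simp only [this, Finset.sum_add_distrib, ← Finset.mul_sum, Finset.sum_ite_eq, Finset.mem_univ,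
    if_true, sq]

lemma gaussCov_equiLaw {ρ : ℝ} (h0 : 0 ≤ ρ) (h1 : ρ ≤ 1) :
    GaussCov (equiLaw ι ρ) fun i j => if i = j then 1 else ρ where
  symm i j := by
    by_cases h : i = j
    · rw [h]
    · rw [if_neg h, if_neg (Ne.symm h)]
  nonneg c := by
    rw [sum_equi_cov]
    have : 0 ≤ ∑ i, c i ^ 2 := Finset.sum_nonneg fun i _ => sq_nonneg _
    have h2 : 0 ≤ 1 - ρ := by linarith
    positivity
  map_eq c := by
    have hm : Measurable fun v : ι → ℝ => ∑ i, c i * v i := by fun_prop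
    have hl : Measurable fun h : ι → ℝ => ∑ i, (√(1 - ρ) * c i) * h i := by fun_prop
    have hz : Measurable fun z : ℝ => (√ρ * ∑ i, c i) * z := by fun_prop
    have hcomp : (fun v : ι → ℝ => ∑ i, c i * v i) ∘
        (fun (p : ℝ × (ι → ℝ)) (i : ι) => √(1 - ρ) * p.2 i + √ρ * p.1) =
        (fun q : ℝ × ℝ => q.1 + q.2) ∘ Prod.map (fun z : ℝ => (√ρ * ∑ i, c i) * z)
          (fun h : ι → ℝ => ∑ i, (√(1 - ρ) * c i) * h i) := by
      ext p
      simp only [Function.comp_apply, Prod.map, Finset.mul_sum, Finset.sum_mul,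
        ← Finset.sum_add_distrib]
      exact Finset.sum_congr rfl fun i _ => by ring
    rw [equiLaw, Measure.map_map hm (measurable_equiMap ρ), hcomp,
      ← Measure.map_map (by fun_prop) (hz.prodMap hl), ← Measure.map_prod_map _ _ hz hl,
      map_linearForm_stdG, gaussianReal_map_const_mul]
    have := gaussianReal_conv_gaussianReal (m₁ := √ρ * (∑ i, c i) * 0) (m₂ := 0)
      (v₁ := NNReal.mk ((√ρ * ∑ i, c i) ^ 2) (sq_nonneg _) * 1)
      (v₂ := (∑ a, (√(1 - ρ) * c a) ^ 2).toNNReal)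
    rw [Measure.conv] at this
    refine Eq.trans this ?_
    have hv : 0 ≤ ∑ a, (√(1 - ρ) * c a) ^ 2 := Finset.sum_nonneg fun i _ => sq_nonneg _
    congr 1
    · simp
    · rw [sum_equi_cov]
      have e1 : ∑ a, (√(1 - ρ) * c a) ^ 2 = (1 - ρ) * ∑ a, c a ^ 2 := by
        rw [Finset.mul_sum]
        exact Finset.sum_congr rfl fun i _ => by rw [mul_pow, sq_sqrt (by linarith)]
      have e2 : (√ρ * ∑ i, c i) ^ 2 = ρ * (∑ i, c i) ^ 2 := by rw [mul_pow, sq_sqrt h0]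
      apply NNReal.coe_injective
      rw [NNReal.coe_add, Real.coe_toNNReal _ hv, Real.coe_toNNReal, e1]
      · rw [mul_one, NNReal.coe_mk, e2]
        ring
      · have : 0 ≤ ∑ i, c i ^ 2 := Finset.sum_nonneg fun i _ => sq_nonneg _
        have h2 : 0 ≤ 1 - ρ := by linarith
        positivity

lemma preimage_countEvent_equiMap (e : ι → Bool) (K M : ℕ) (u₁ u₂ : ℝ) {ρ : ℝ} (h1 : ρ < 1)
    (z : ℝ) :
    Prod.mk z ⁻¹' ((fun (p : ℝ × (ι → ℝ)) (i : ι) => √(1 - ρ) * p.2 i + √ρ * p.1) ⁻¹'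
      countEvent e K M u₁ u₂) =
      countEvent e K M ((u₁ - √ρ * z) / √(1 - ρ)) ((u₂ - √ρ * z) / √(1 - ρ)) := by
  have h : ∀ u t : ℝ, (u < √(1 - ρ) * t + √ρ * z) ↔ (u - √ρ * z) / √(1 - ρ) < t := by
    intro u t
    rw [div_lt_iff₀ (sqrt_pos.2 (by linarith))]
    constructor <;> intro h <;> linarith
  ext v
  simp only [Set.mem_preimage, countEvent, Set.mem_ofPred_eq, h]

lemma measurable_stdG_countEvent (e : ι → Bool) (K M : ℕ) (u₁ u₂ : ℝ) {ρ : ℝ} (h1 : ρ < 1) :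
    Measurable fun z : ℝ => stdG ι (countEvent e K M ((u₁ - √ρ * z) / √(1 - ρ))
      ((u₂ - √ρ * z) / √(1 - ρ))) := by
  have := measurable_measure_prodMk_left (ν := stdG ι)
    (measurable_equiMap (ι := ι) ρ (measurableSet_countEvent (e := e) (K := K) (M := M)
      (u₁ := u₁) (u₂ := u₂)))
  simpa only [preimage_countEvent_equiMap e K M u₁ u₂ h1] using this

lemma equiLaw_countEvent_toReal (e : ι → Bool) (K M : ℕ) (u₁ u₂ : ℝ) {ρ : ℝ} (h1 : ρ < 1) :
    (equiLaw ι ρ (countEvent e K M u₁ u₂)).toReal =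
      ∫ z, (stdG ι (countEvent e K M ((u₁ - √ρ * z) / √(1 - ρ))
        ((u₂ - √ρ * z) / √(1 - ρ)))).toReal ∂gaussianReal 0 1 := by
  rw [equiLaw, Measure.map_apply (measurable_equiMap ρ) measurableSet_countEvent,
    Measure.prod_apply (measurable_equiMap ρ measurableSet_countEvent),
    integral_toReal (measurable_stdG_countEvent e K M u₁ u₂ h1).aemeasurable
      (ae_of_all _ fun _ => measure_lt_top _ _)]
  simp only [preimage_countEvent_equiMap e K M u₁ u₂ h1]

end Equicorrelated

/-- The conditional limit probability given the common factor `z` and the observed density `ℓ`. -/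
noncomputable def condLimit (γ x y : ℝ) (K M : ℕ) (ℓ z : ℝ) : ℝ :=
  ∑ t ∈ Finset.range (M + 1), ∑ i ∈ Finset.range (M + 1 - t), ∑ j ∈ Finset.range (min i K + 1),
    poissonTerm ℓ (g γ x z) (g γ y z) t j (i - j)

lemma tendsto_equiLaw_countEvent {γ x y ℓ : ℝ} (hxy : y ≤ x) (K M : ℕ)
    {F : Filter ℕ} [F.IsCountablyGenerated] (hF : F ≤ atTop) {e : ∀ n, Fin n → Bool}
    (he : Tendsto (fun n => ((Finset.univ.filter fun i => e n i = true).card : ℝ) / n) F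
      (nhds ℓ)) :
    Tendsto (fun n : ℕ => (equiLaw (Fin n) (γ / log n)
        (countEvent (e n) K M (un n x) (un n y))).toReal) F
      (nhds (∫ z, condLimit γ x y K M ℓ z ∂gaussianReal 0 1)) := by
  have hρ : Tendsto (fun n : ℕ => γ / log n) atTop (nhds 0) :=
    tendsto_log_natCast.const_div_atTop γ
  have hlt := hF (hρ.eventually_lt_const one_pos)
  have hcond : Tendsto (fun n : ℕ => ∫ z, (stdG (Fin n) (countEvent (e n) K M
      ((un n x - √(γ / log n) * z) / √(1 - γ / log n))
      ((un n y - √(γ / log n) * z) / √(1 - γ / log n)))).toReal ∂gaussianReal 0 1) F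
      (nhds (∫ z, condLimit γ x y K M ℓ z ∂gaussianReal 0 1)) := by
    refine tendsto_integral_filter_of_dominated_convergence (fun _ => 1) ?_ ?_
      (integrable_const _) ?_
    · filter_upwards [hlt] with n hn
      exact (measurable_stdG_countEvent _ _ _ _ _ hn).ennreal_toReal.aestronglyMeasurable
    · refine Eventually.of_forall fun n => ae_of_all _ fun z => ?_
      rw [norm_of_nonneg ENNReal.toReal_nonneg]
      exact measureReal_le_one
    · refine ae_of_all _ fun z => ?_
      have hl : Tendsto (fun n : ℕ => ∑ t ∈ Finset.range (M + 1),
          ∑ i ∈ Finset.range (M + 1 - t), ∑ j ∈ Finset.range (min i K + 1),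
          trialProb (Finset.univ.filter fun i => e n i = false).card
            (Finset.univ.filter fun i => e n i = true).card
            (condTail γ n x z) (condTail γ n y z) t j (i - j)) F
          (nhds (condLimit γ x y K M ℓ z)) := by
        refine tendsto_finsetSum _ fun t _ => tendsto_finsetSum _ fun i _ =>
          tendsto_finsetSum _ fun j _ => ?_
        refine tendsto_trialProb hF (fun n => ?_) he (tendsto_mul_condTail γ x z)
          (tendsto_mul_condTail γ y z) t j (i - j)
        have := Finset.card_filter_add_card_filter_not
          (s := (Finset.univ : Finset (Fin n))) (fun i => e n i = true)
        simp only [Bool.not_eq_true, Finset.card_univ, Fintype.card_fin] at this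
        omega
      refine hl.congr' ?_
      filter_upwards [hlt] with n hn
      rw [stdG_countEvent_toReal]
      · rfl
      · have : un n y ≤ un n x := by
          unfold un
          gcongr
        gcongr
  refine hcond.congr' ?_
  filter_upwards [hlt] with n hn
  rw [equiLaw_countEvent_toReal _ _ _ _ _ hn]

section ComparisonSum

lemma sum_log_div_le (n : ℕ) : ∑ d ∈ Finset.Ico 1 n, (log n - log d) ≤ n := by
  have h : (n : ℝ) ^ n / (Nat.factorial n : ℝ) ≤ rexp n :=
    pow_div_factorial_le_exp n n.cast_nonneg n
  rcases Nat.eq_zero_or_pos n with rfl | hn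
  · simp
  have hn' : (0 : ℝ) < n := by exact_mod_cast hn
  have hf : (0 : ℝ) < (Nat.factorial n : ℝ) := by exact_mod_cast Nat.factorial_pos n
  have h2 := log_le_log (by positivity) h
  rw [log_exp, log_div (by positivity) hf.ne', log_pow] at h2
  have h3 : log (Nat.factorial n : ℝ) = ∑ d ∈ Finset.Ico 1 (n + 1), log (d : ℝ) := by
    rw [← Finset.prod_Ico_id_eq_factorial, Nat.cast_prod, log_prod]
    intro d hd
    have := (Finset.mem_Ico.1 hd).1
    positivity
  rw [h3, Finset.sum_Ico_succ_top hn] at h2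
  rw [Finset.sum_sub_distrib, Finset.sum_const, Nat.card_Ico, nsmul_eq_mul,
    Nat.cast_sub (show 1 ≤ n from hn)]
  push_cast
  linarith

lemma card_filter_log_lt_le (n : ℕ) (α : ℝ) :
    ((((Finset.Ico 1 n).filter fun d : ℕ => log d < α * log n).card : ℕ) : ℝ) ≤ (n : ℝ) ^ α := by
  rcases Nat.eq_zero_or_pos n with rfl | hn
  · simpa using rpow_nonneg le_rfl α
  have hn' : (0 : ℝ) < n := by exact_mod_cast hn
  have hsub : (Finset.Ico 1 n).filter (fun d : ℕ => log d < α * log n) ⊆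
      Finset.Ioc 0 ⌊(n : ℝ) ^ α⌋₊ := by
    intro d hd
    rw [Finset.mem_filter, Finset.mem_Ico] at hd
    have hd0 : (0 : ℝ) < d := by exact_mod_cast hd.1.1
    rw [Finset.mem_Ioc]
    refine ⟨hd.1.1, Nat.le_floor ?_⟩
    rw [rpow_def_of_pos hn', ← exp_log hd0, mul_comm]
    exact exp_le_exp.2 hd.2.le
  calc ((((Finset.Ico 1 n).filter fun d : ℕ => log d < α * log n).card : ℕ) : ℝ)
      ≤ ((Finset.Ioc 0 ⌊(n : ℝ) ^ α⌋₊).card : ℝ) := by exact_mod_cast Finset.card_le_card hsub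
    _ = (⌊(n : ℝ) ^ α⌋₊ : ℝ) := by simp
    _ ≤ (n : ℝ) ^ α := Nat.floor_le (by positivity)

lemma tendsto_near_part {α β : ℝ} (h : 1 + α < β) {C₀ : ℝ} (hC₀ : 0 ≤ C₀) :
    Tendsto (fun n : ℕ => (n : ℝ) * ((n : ℝ) ^ α * (2 * (C₀ * (√(2 * log n) / n)) ^ β))) atTop
      (nhds 0) := by
  have h1 : Tendsto (fun x : ℝ => log x ^ (β / 2) / x ^ (β - (1 + α))) atTop (nhds 0) :=
    (isLittleO_log_rpow_rpow_atTop (β / 2) (sub_pos.2 h)).tendsto_div_nhds_zero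
  have h2 := (h1.comp (tendsto_natCast_atTop_atTop (R := ℝ))).const_mul
    (2 * C₀ ^ β * (2 : ℝ) ^ (β / 2))
  rw [mul_zero] at h2
  refine h2.congr' ?_
  filter_upwards [eventually_gt_atTop 1] with n hn
  have hn' : (0 : ℝ) < n := by exact_mod_cast (by omega : 0 < n)
  have hl : 0 < log (n : ℝ) := log_pos (by exact_mod_cast hn)
  simp only [Function.comp_apply]
  rw [mul_rpow hC₀ (by positivity), div_rpow (sqrt_nonneg _) hn'.le, sqrt_eq_rpow,
    ← rpow_mul (by positivity), mul_rpow (by norm_num) hl.le, rpow_sub hn', rpow_add hn', rpow_one,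
    show 1 / 2 * β = β / 2 by ring]
  field_simp

variable {r : ℕ → ℝ} {γ δ : ℝ}

lemma abs_le_of_log_le {n d : ℕ} {α B : ℝ} (hL : 0 < log (n : ℝ)) (hα : 0 < α)
    (hd : α * log n ≤ log d) (hB : |r d * log d| ≤ B) : |r d| ≤ B / α / log n := by
  have hld : 0 < log (d : ℝ) := lt_of_lt_of_le (by positivity) hd
  rw [div_div, le_div_iff₀ (by positivity)]
  calc |r d| * (α * log n) ≤ |r d| * log d := by gcongr
    _ = |r d * log d| := by rw [abs_mul, abs_of_pos hld]
    _ ≤ B := hB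

lemma sub_div_log_le {n d : ℕ} {α B : ℝ} (hL : 0 < log (n : ℝ)) (hα : 0 < α)
    (hd : α * log n ≤ log d) (hdn : log d ≤ log n)
    (hB : |r d * log d| ≤ B) :
    |r d - γ / log n| ≤
      1 / log n * (|r d * log d - γ| + B / α / log n * (log n - log d)) := by
  have hld : 0 < log (d : ℝ) := lt_of_lt_of_le (by positivity) hd
  have hr : |r d| ≤ B / α / log n := abs_le_of_log_le hL hα hd hB
  have e : r d - γ / log n = 1 / log n * ((r d * log d - γ) + r d * (log n - log d)) := by
    field_simp; ring
  rw [e, abs_mul, abs_of_pos (by positivity)]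
  gcongr
  refine (abs_add_le _ _).trans ?_
  rw [abs_mul, abs_of_nonneg (sub_nonneg.2 hdn)]
  have := sub_nonneg.2 hdn
  gcongr

lemma exp_neg_div_le {u ω E D : ℝ} (hω : 0 ≤ ω) (hE : rexp (-u ^ 2 / 2) ≤ E) (hD : u ^ 2 * ω ≤ D) :
    rexp (-u ^ 2 / (1 + ω)) ≤ E ^ 2 * rexp D := by
  have h1 : -u ^ 2 / (1 + ω) ≤ -u ^ 2 / 2 + -u ^ 2 / 2 + u ^ 2 * ω := by
    rw [div_le_iff₀ (by positivity)]
    nlinarith [mul_nonneg (sq_nonneg u) (sq_nonneg ω)]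
  calc rexp (-u ^ 2 / (1 + ω)) ≤ rexp (-u ^ 2 / 2 + -u ^ 2 / 2 + u ^ 2 * ω) := exp_le_exp.2 h1
    _ = rexp (-u ^ 2 / 2) ^ 2 * rexp (u ^ 2 * ω) := by rw [exp_add, exp_add, sq (rexp _)]
    _ ≤ E ^ 2 * rexp D := by gcongr

lemma exp_neg_div_le_rpow {u ω δ E : ℝ} (hω : 0 ≤ ω) (hδ : ω ≤ δ)
    (hE : rexp (-u ^ 2 / 2) ≤ E) : rexp (-u ^ 2 / (1 + ω)) ≤ E ^ (2 / (1 + δ)) := by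
  have h1 : -u ^ 2 / (1 + ω) ≤ -u ^ 2 / 2 * (2 / (1 + δ)) := by
    have : -u ^ 2 / 2 * (2 / (1 + δ)) = -(u ^ 2 / (1 + δ)) := by
      field_simp
    rw [this, neg_div, neg_le_neg_iff]
    gcongr
  have h0 : 0 ≤ 2 / (1 + δ) := by have := hω.trans hδ; positivity
  calc rexp (-u ^ 2 / (1 + ω)) ≤ rexp (-u ^ 2 / 2 * (2 / (1 + δ))) := exp_le_exp.2 h1
    _ = rexp (-u ^ 2 / 2) ^ (2 / (1 + δ)) := exp_mul _ _
    _ ≤ E ^ (2 / (1 + δ)) := by gcongr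

lemma tendsto_comparisonSum (hγ : 0 ≤ γ) (hr : Tendsto (fun n => r n * log n) atTop (nhds γ))
    (hδ0 : 0 < δ) (hδ1 : δ < 1) (hrδ : ∀ d, 1 ≤ d → |r d| ≤ δ) (y : ℝ) :
    Tendsto (fun n : ℕ => n * ∑ d ∈ Finset.Ico 1 n, |r d - γ / log n| *
      rexp (-un n y ^ 2 / (1 + max |r d| (γ / log n)))) atTop (nhds 0) := by
  obtain ⟨B₀, hB₀⟩ := hr.abs.bddAbove_range
  set B := max B₀ γ
  have hB : ∀ d : ℕ, |r d * log d| ≤ B := fun d =>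
    (hB₀ (Set.mem_range_self d)).trans (le_max_left _ _)
  have hγB : γ ≤ B := le_max_right _ _
  set β := 2 / (1 + δ)
  have hβ : 1 < β := by rw [lt_div_iff₀ (by positivity)]; linarith
  have hβ2 : β < 2 := by rw [div_lt_iff₀ (by positivity)]; linarith
  set α := (β - 1) / 2
  have hα : 0 < α := by simp only [α]; linarith
  have hα1 : α < 1 := by simp only [α]; linarith
  have hαβ : 1 + α < β := by simp only [α]; linarith
  set K := B / α
  have hB0 : 0 ≤ B := hγ.trans hγB
  have hγK : γ ≤ K := by
    rw [le_div_iff₀ hα]; nlinarith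
  have hK0 : 0 ≤ K := hγ.trans hγK
  set C₀ := √(2 * π) * rexp (-y)
  have hC₀ : 0 ≤ C₀ := by positivity
  set C₁ := 2 * C₀ ^ 2 * rexp (8 * K)
  have hC₁ : 0 ≤ C₁ := by positivity
  have hcesaro : Tendsto (fun n : ℕ => (n : ℝ)⁻¹ * ∑ d ∈ Finset.range n, |r d * log d - γ|) atTop
      (nhds 0) := by
    have : Tendsto (fun n => |r n * log n - γ|) atTop (nhds 0) := by
      simpa using (hr.sub_const γ).abs
    exact this.cesaro
  have hbound : Tendsto (fun n : ℕ =>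
      (n : ℝ) * ((n : ℝ) ^ α * (2 * (C₀ * (√(2 * log n) / n)) ^ β)) +
      C₁ * ((n : ℝ)⁻¹ * ∑ d ∈ Finset.range n, |r d * log d - γ| + K / log n)) atTop (nhds 0) := by
    have := (tendsto_near_part hαβ hC₀).add
      ((hcesaro.add (tendsto_log_natCast.const_div_atTop K)).const_mul C₁)
    simpa using this
  refine tendsto_of_tendsto_of_tendsto_of_le_of_le' tendsto_const_nhds hbound
    (Eventually.of_forall fun n => by positivity) ?_
  have hdiv := (tendsto_un_div (tendsto_const_nhds (x := y))).eventually_lt_const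
    (show (1 : ℝ) < 2 by norm_num)
  filter_upwards [eventually_gt_atTop 1, hdiv,
    (tendsto_un (tendsto_const_nhds (x := y))).eventually_ge_atTop 0,
    (tendsto_log_natCast.const_div_atTop γ).eventually_lt_const hδ0] with n hn hu hu0 hρδ
  have hn' : (0 : ℝ) < n := by exact_mod_cast (by omega : 0 < n)
  have hL : 0 < log (n : ℝ) := log_pos (by exact_mod_cast hn)
  have hu8 : un n y ^ 2 ≤ 8 * log n := by
    rw [div_lt_iff₀ (by positivity)] at hu
    have h0 : (√(2 * log (n : ℝ))) ^ 2 = 2 * log n := sq_sqrt (by positivity)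
    nlinarith
  have hE := exp_neg_sq_un_le hn y
  have hρ0 : 0 ≤ γ / log n := by positivity
  have hpt : ∀ d ∈ Finset.Ico 1 n, |r d - γ / log n| *
      rexp (-un n y ^ 2 / (1 + max |r d| (γ / log n))) ≤
      (if log d < α * log n then 2 * (C₀ * (√(2 * log n) / n)) ^ β else 0) +
      C₁ / n ^ 2 * (|r d * log d - γ| + K / log n * (log n - log d)) := by
    intro d hd
    rw [Finset.mem_Ico] at hd
    have hdn : log (d : ℝ) ≤ log n :=
      log_le_log (by exact_mod_cast hd.1) (by exact_mod_cast hd.2.le)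
    have hω0 : 0 ≤ max |r d| (γ / log n) := le_max_of_le_right hρ0
    have hdn' := sub_nonneg.2 hdn
    split_ifs with hc
    · have h1 : |r d - γ / log n| ≤ 2 := by
        refine (abs_sub _ _).trans ?_
        rw [abs_of_nonneg hρ0]
        linarith [hrδ d hd.1]
      have h2 := exp_neg_div_le_rpow hω0 (max_le (hrδ d hd.1) hρδ.le) hE
      have h3 : 0 ≤ C₁ / n ^ 2 * (|r d * log d - γ| + K / log n * (log n - log d)) := by positivity
      have := mul_le_mul h1 h2 (exp_nonneg _) (by norm_num)
      linarith
    · push Not at hc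
      rw [zero_add]
      have h1 := sub_div_log_le (γ := γ) hL hα hc hdn (hB d)
      have hω : max |r d| (γ / log n) ≤ K / log n :=
        max_le (abs_le_of_log_le hL hα hc (hB d)) (by gcongr)
      have hD : un n y ^ 2 * max |r d| (γ / log n) ≤ 8 * K := by
        calc un n y ^ 2 * max |r d| (γ / log n) ≤ 8 * log n * (K / log n) := by gcongr
          _ = 8 * K := by field_simp
      have h2 := exp_neg_div_le hω0 hE hD
      refine (mul_le_mul h1 h2 (exp_nonneg _) (by positivity)).trans (le_of_eq ?_)
      have : (C₀ * (√(2 * log (n : ℝ)) / n)) ^ 2 = C₀ ^ 2 * (2 * log n) / n ^ 2 := by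
        rw [mul_pow, div_pow, sq_sqrt (by positivity)]; ring
      change 1 / log n * (|r d * log d - γ| + K / log n * (log n - log d)) *
        ((C₀ * (√(2 * log (n : ℝ)) / n)) ^ 2 * rexp (8 * K)) = _
      rw [this]
      simp only [C₁]
      field_simp
  have hsum := Finset.sum_le_sum hpt
  rw [Finset.sum_add_distrib, ← Finset.sum_filter, Finset.sum_const, nsmul_eq_mul,
    ← Finset.mul_sum, Finset.sum_add_distrib, ← Finset.mul_sum] at hsum
  have hcard := card_filter_log_lt_le n α
  have hlogs := sum_log_div_le n
  have hces : ∑ d ∈ Finset.Ico 1 n, |r d * log d - γ| ≤ ∑ d ∈ Finset.range n, |r d * log d - γ| :=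
    Finset.sum_le_sum_of_subset_of_nonneg
      (fun d hd => Finset.mem_range.2 (Finset.mem_Ico.1 hd).2) fun _ _ _ => abs_nonneg _
  calc _ ≤ (n : ℝ) * ((n : ℝ) ^ α * (2 * (C₀ * (√(2 * log n) / n)) ^ β) +
        C₁ / n ^ 2 * (∑ d ∈ Finset.range n, |r d * log d - γ| + K / log n * n)) := by
        gcongr
        refine hsum.trans ?_
        gcongr
    _ = _ := by field_simp

end ComparisonSum

section Covariance

variable {Ω : Type*} [MeasurableSpace Ω] {P : Measure Ω}

lemma memLp_two_of_map_eq_gaussianReal {Y : Ω → ℝ} (hY : Measurable Y) {v : ℝ≥0}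
    (h : P.map Y = gaussianReal 0 v) : MemLp Y 2 P := by
  have := memLp_id_gaussianReal (μ := 0) (v := v) 2
  rw [← h, ENNReal.coe_ofNat, memLp_map_measure_iff (by fun_prop) hY.aemeasurable] at this
  exact this

lemma integral_sq_of_map_eq_gaussianReal {Y : Ω → ℝ} (hY : Measurable Y) {v : ℝ≥0}
    (h : P.map Y = gaussianReal 0 v) : ∫ ω, Y ω ^ 2 ∂P = v := by
  have h1 : ∫ ω, Y ω ^ 2 ∂P = ∫ x, x ^ 2 ∂gaussianReal 0 v := by
    rw [← h, integral_map hY.aemeasurable (by fun_prop)]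
  have h2 := variance_id_gaussianReal (μ := 0) (v := v)
  rw [variance_eq_integral (by fun_prop)] at h2
  simpa [h1] using h2

lemma integral_sq_linearForm {ι : Type*} [Fintype ι] {Y : ι → Ω → ℝ}
    (hY : ∀ i, MemLp (Y i) 2 P) (c : ι → ℝ) :
    ∫ ω, (∑ i, c i * Y i ω) ^ 2 ∂P = ∑ i, ∑ j, c i * c j * ∫ ω, Y i ω * Y j ω ∂P := by
  have hi : ∀ i j, Integrable (fun ω => c i * c j * (Y i ω * Y j ω)) P := fun i j =>
    ((hY i).integrable_mul (hY j)).const_mul _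
  have : ∀ ω, (∑ i, c i * Y i ω) ^ 2 = ∑ i, ∑ j, c i * c j * (Y i ω * Y j ω) := by
    intro ω
    rw [sq, Finset.sum_mul_sum]
    exact Finset.sum_congr rfl fun i _ => Finset.sum_congr rfl fun j _ => by ring
  simp_rw [this]
  rw [integral_finsetSum _ fun i _ => integrable_finsetSum _ fun j _ => hi i j]
  refine Finset.sum_congr rfl fun i _ => ?_
  rw [integral_finsetSum _ fun j _ => hi i j]
  exact Finset.sum_congr rfl fun j _ => integral_const_mul _ _

lemma gaussCov_map {ι : Type*} [Fintype ι] {Y : ι → Ω → ℝ} (hY : ∀ i, Measurable (Y i))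
    (hlin : ∀ c : ι → ℝ, ∃ v : ℝ≥0, P.map (fun ω => ∑ i, c i * Y i ω) = gaussianReal 0 v) :
    GaussCov (P.map fun ω i => Y i ω) fun i j => ∫ ω, Y i ω * Y j ω ∂P := by
  have hL2 : ∀ i, MemLp (Y i) 2 P := by
    intro i
    obtain ⟨v, hv⟩ := hlin (Pi.single i 1)
    refine memLp_two_of_map_eq_gaussianReal (v := v) (hY i) ?_
    simpa [Pi.single_apply] using hv
  refine ⟨fun i j => by simp_rw [mul_comm], fun c => ?_, fun c => ?_⟩
  · rw [← integral_sq_linearForm hL2]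
    exact integral_nonneg fun ω => sq_nonneg _
  · obtain ⟨v, hv⟩ := hlin c
    have hm : Measurable fun ω => ∑ i, c i * Y i ω := by fun_prop
    have := integral_sq_of_map_eq_gaussianReal hm hv
    rw [integral_sq_linearForm hL2] at this
    rw [this, toNNReal_coe, ← hv, Measure.map_map (by fun_prop) (by fun_prop)]
    rfl

variable {X : ℕ → Ω → ℝ}

lemma integral_mul_add_of_stationary (hX : ∀ n, Measurable (X n))
    (hstat : ∀ m k : ℕ, P.map (fun ω => fun i : Fin m => X (i.1 + 1 + k) ω) =
      P.map (fun ω => fun i : Fin m => X (i.1 + 1) ω)) (k d : ℕ) :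
    ∫ ω, X (k + 1) ω * X (k + d + 1) ω ∂P = ∫ ω, X 1 ω * X (d + 1) ω ∂P := by
  have key : ∀ l : ℕ, ∫ ω, X (0 + 1 + l) ω * X (d + 1 + l) ω ∂P =
      ∫ v, v 0 * v (Fin.last d) ∂P.map (fun ω => fun i : Fin (d + 1) => X (i.1 + 1 + l) ω) := by
    intro l
    rw [integral_map (by fun_prop) (by fun_prop)]
    rfl
  have h0 := key 0
  have hk := key k
  rw [hstat] at hk
  rw [show k + 1 = 0 + 1 + k by ring, show k + d + 1 = d + 1 + k by ring, hk]
  exact h0.symm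

lemma integral_mul_eq_of_stationary (hX : ∀ n, Measurable (X n))
    (hstat : ∀ m k : ℕ, P.map (fun ω => fun i : Fin m => X (i.1 + 1 + k) ω) =
      P.map (fun ω => fun i : Fin m => X (i.1 + 1) ω)) (i j : ℕ) :
    ∫ ω, X (i + 1) ω * X (j + 1) ω ∂P = ∫ ω, X 1 ω * X (Nat.dist i j + 1) ω ∂P := by
  rcases le_total i j with h | h
  · obtain ⟨d, rfl⟩ := Nat.exists_eq_add_of_le h
    rw [integral_mul_add_of_stationary hX hstat, Nat.dist_eq_sub_of_le h, Nat.add_sub_cancel_left]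
  · obtain ⟨d, rfl⟩ := Nat.exists_eq_add_of_le h
    simp_rw [mul_comm (X (j + d + 1) _)]
    rw [integral_mul_add_of_stationary hX hstat, Nat.dist_comm, Nat.dist_eq_sub_of_le h,
      Nat.add_sub_cancel_left]

lemma abs_covariance_lt_one (hX : ∀ n, MemLp (X n) 2 P) (hsq : ∀ n, ∫ ω, X n ω ^ 2 ∂P = 1)
    (hcov : ∀ k d : ℕ, ∫ ω, X (k + 1) ω * X (k + d + 1) ω ∂P = ∫ ω, X 1 ω * X (d + 1) ω ∂P)
    (h0 : Tendsto (fun n : ℕ => ∫ ω, X 1 ω * X (n + 1) ω ∂P) atTop (nhds 0)) {d : ℕ}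
    (hd : 1 ≤ d) : |∫ ω, X 1 ω * X (d + 1) ω ∂P| < 1 := by
  set s := ∫ ω, X 1 ω * X (d + 1) ω ∂P
  have hexp : ∀ (t : ℝ) (k : ℕ), ∫ ω, (X (k + d + 1) ω - t * X (k + 1) ω) ^ 2 ∂P =
      1 - 2 * t * s + t ^ 2 := by
    intro t k
    have i1 := (hX (k + d + 1)).integrable_sq
    have i2 := (hX (k + 1)).integrable_sq
    have i3 : Integrable (fun ω => X (k + 1) ω * X (k + d + 1) ω) P :=
      (hX (k + 1)).integrable_mul (hX (k + d + 1))
    have : ∀ ω, (X (k + d + 1) ω - t * X (k + 1) ω) ^ 2 =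
        X (k + d + 1) ω ^ 2 - 2 * t * (X (k + 1) ω * X (k + d + 1) ω) + t ^ 2 * X (k + 1) ω ^ 2 :=
      fun ω => by ring
    simp_rw [this]
    have i4 : Integrable (fun ω => X (k + d + 1) ω ^ 2 -
        2 * t * (X (k + 1) ω * X (k + d + 1) ω)) P := i1.sub (i3.const_mul _)
    rw [integral_add i4 (i2.const_mul _), integral_sub i1 (i3.const_mul _),
      integral_const_mul, integral_const_mul, hsq, hsq, hcov]
    simp only [s]
    ring
  have hs : s ^ 2 ≤ 1 := by
    have := integral_nonneg (μ := P) (f := fun ω => (X (0 + d + 1) ω - s * X (0 + 1) ω) ^ 2)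
      fun ω => sq_nonneg _
    rw [hexp s 0] at this
    nlinarith
  refine lt_of_le_of_ne ((sq_le_one_iff_abs_le_one s).1 hs) fun habs => ?_
  have hs1 : s ^ 2 = 1 := by rw [← sq_abs, habs, one_pow]
  have hstep : ∀ k, X (k + d + 1) =ᵐ[P] fun ω => s * X (k + 1) ω := by
    intro k
    have h := hexp s k
    have hi : Integrable (fun ω => (X (k + d + 1) ω - s * X (k + 1) ω) ^ 2) P :=
      ((hX _).sub ((hX _).const_mul s)).integrable_sq
    rw [show 1 - 2 * s * s + s ^ 2 = 0 by linarith [sq s], integral_eq_zero_iff_of_nonneg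
      (fun ω => sq_nonneg _) hi] at h
    filter_upwards [h] with ω hω
    have := pow_eq_zero_iff (two_ne_zero) |>.1 hω
    linarith
  have hpow : ∀ n : ℕ, X (n * d + 1) =ᵐ[P] fun ω => s ^ n * X 1 ω := by
    intro n
    induction n with
    | zero => simp
    | succ n ih =>
      rw [Nat.succ_mul]
      filter_upwards [ih, hstep (n * d)] with ω h1 h2
      rw [h2, h1, pow_succ]; ring
  have hr : ∀ n : ℕ, ∫ ω, X 1 ω * X (n * d + 1) ω ∂P = s ^ n := by
    intro n
    have : (fun ω => X 1 ω * X (n * d + 1) ω) =ᵐ[P] fun ω => s ^ n * X 1 ω ^ 2 := by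
      filter_upwards [hpow n] with ω h
      rw [h]; ring
    rw [integral_congr_ae this, integral_const_mul, hsq, mul_one]
  have hlim : Tendsto (fun n : ℕ => n * d) atTop atTop :=
    tendsto_id.atTop_mul_const' hd
  have := (h0.comp hlim).abs
  have hone : (fun n => |((fun n : ℕ => ∫ ω, X 1 ω * X (n + 1) ω ∂P) ∘ fun n => n * d) n|) =
      fun _ => (1 : ℝ) := by
    ext n
    simp only [Function.comp_apply, hr, abs_pow, habs, one_pow]
  rw [hone, abs_zero] at this
  exact one_ne_zero (tendsto_nhds_unique tendsto_const_nhds this)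

lemma exists_bound_lt_one {r : ℕ → ℝ} (h0 : Tendsto r atTop (nhds 0))
    (h1 : ∀ d, 1 ≤ d → |r d| < 1) : ∃ δ, 0 < δ ∧ δ < 1 ∧ ∀ d, 1 ≤ d → |r d| ≤ δ := by
  have h2 := h0.abs.eventually_lt_const (show |(0 : ℝ)| < 1 / 2 by norm_num)
  obtain ⟨N, hN⟩ := eventually_atTop.1 h2
  have h3 : ∀ M : ℕ, ∃ δ, 1 / 2 ≤ δ ∧ δ < 1 ∧ ∀ d, 1 ≤ d → d < M → |r d| ≤ δ := by
    intro M
    induction M with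
    | zero => exact ⟨1 / 2, le_rfl, by norm_num, fun d _ h => by omega⟩
    | succ M ih =>
      obtain ⟨δ, h4, h5, h6⟩ := ih
      rcases Nat.eq_zero_or_pos M with rfl | hM
      · exact ⟨δ, h4, h5, fun d _ h => by omega⟩
      · refine ⟨max δ |r M|, le_max_of_le_left h4, max_lt h5 (h1 M hM), fun d hd hdM => ?_⟩
        rcases Nat.lt_succ_iff_lt_or_eq.1 hdM with h | rfl
        · exact (h6 d hd h).trans (le_max_left _ _)
        · exact le_max_right _ _
  obtain ⟨δ, h4, h5, h6⟩ := h3 N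
  refine ⟨δ, by linarith, h5, fun d hd => ?_⟩
  rcases lt_or_ge d N with h | h
  · exact h6 d hd h
  · exact (hN d h).le.trans h4

end Covariance

section Toeplitz

lemma sum_dist_le {n : ℕ} {F : ℕ → ℝ} (hF : ∀ d, 0 ≤ F d) (i : Fin n) :
    ∑ j : Fin n, (if i = j then 0 else F (Nat.dist i j)) ≤ 2 * ∑ d ∈ Finset.Ico 1 n, F d := by
  have hpt : ∀ j : Fin n, (if i = j then 0 else F (Nat.dist i j)) ≤
      ∑ d ∈ Finset.Ico 1 n,
        ((if (j : ℕ) = i + d then F d else 0) + (if (i : ℕ) = j + d then F d else 0)) := by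
    intro j
    have hnn : ∀ d, 0 ≤ (if (j : ℕ) = i + d then F d else 0) +
        (if (i : ℕ) = j + d then F d else 0) := fun d => by
      have := hF d
      split_ifs <;> linarith
    split_ifs with h
    · exact Finset.sum_nonneg fun d _ => hnn d
    · have hne : (i : ℕ) ≠ j := fun h' => h (Fin.ext h')
      refine le_trans ?_ (Finset.single_le_sum (fun d _ => hnn d)
        (Finset.mem_Ico.2 (?_ : 1 ≤ Nat.dist i j ∧ Nat.dist i j < n)))
      · rcases lt_or_gt_of_ne hne with h | h
        · rw [if_pos (by rw [Nat.dist_eq_sub_of_le h.le]; omega)]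
          have := hF (Nat.dist i j)
          split_ifs <;> linarith
        · rw [if_pos (c := (i : ℕ) = _) (by rw [Nat.dist_eq_sub_of_le_right h.le]; omega)]
          have := hF (Nat.dist i j)
          split_ifs <;> linarith
      · have := i.2
        have := j.2
        simp only [Nat.dist]
        omega
  refine (Finset.sum_le_sum fun j _ => hpt j).trans ?_
  rw [Finset.sum_comm, Finset.mul_sum]
  refine Finset.sum_le_sum fun d _ => ?_
  have hone : ∀ (p : Fin n → Prop) [DecidablePred p], (∀ a b, p a → p b → a = b) →
      ∑ j, (if p j then F d else 0) ≤ F d := by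
    intro p _ hp
    rw [← Finset.sum_filter, Finset.sum_const, nsmul_eq_mul]
    have : (Finset.univ.filter p).card ≤ 1 := Finset.card_le_one.2 fun a ha b hb =>
      hp a b (Finset.mem_filter.1 ha).2 (Finset.mem_filter.1 hb).2
    calc _ ≤ ((1 : ℕ) : ℝ) * F d := by gcongr; exact hF d
      _ = F d := by simp
  rw [Finset.sum_add_distrib, two_mul]
  exact add_le_add (hone (fun j => (j : ℕ) = i + d) fun a b ha hb => Fin.ext (by omega))
    (hone (fun j => (i : ℕ) = j + d) fun a b ha hb => Fin.ext (by omega))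

end Toeplitz

/-- Uniformly in the masks, replacing the covariances by the equicorrelated ones is harmless. -/
lemma eventually_abs_countEvent_sub_equiLaw_le {r : ℕ → ℝ} {γ : ℝ}
    {μ : ∀ n, Measure (Fin n → ℝ)} [∀ n, IsProbabilityMeasure (μ n)]
    (hμ : ∀ n, GaussCov (μ n) fun i j => r (Nat.dist i j)) (hγ : 0 ≤ γ) (hr0 : r 0 = 1)
    (hr : Tendsto (fun n => r n * log n) atTop (nhds γ)) {δ : ℝ} (hδ0 : 0 < δ) (hδ1 : δ < 1)
    (hrδ : ∀ d, 1 ≤ d → |r d| ≤ δ) {x y : ℝ} (hxy : y ≤ x) (K M : ℕ) {θ : ℝ} (hθ : 0 < θ) :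
    ∀ᶠ n in atTop, ∀ e : Fin n → Bool,
      |(equiLaw (Fin n) (γ / log n) (countEvent e K M (un n x) (un n y))).toReal -
        (μ n (countEvent e K M (un n x) (un n y))).toReal| ≤ θ := by
  obtain ⟨C, hC, hC1, hC2⟩ := exists_bound_deriv_smoothTransition
  set c := √(2 * π) * rexp (-y)
  have hc : 0 < c := by positivity
  set s := θ / (8 * c)
  have hs : 0 < s := by positivity
  set D := 4 * C ^ 2 * (2 * C ^ 2 * ((x - y + s) / s) ^ 2 / (1 - δ))
  have hD : 0 ≤ D := by
    have : 0 < 1 - δ := by linarith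
    positivity
  have hsum := ((tendsto_comparisonSum hγ hr hδ0 hδ1 hrδ y).const_mul
    (4 * D)).eventually_lt_const (show 4 * D * 0 < θ / 2 by rw [mul_zero]; positivity)
  filter_upwards [hsum, eventually_gt_atTop 1,
    (tendsto_un (tendsto_const_nhds (x := y))).eventually_ge_atTop 0,
    (tendsto_log_natCast.const_div_atTop γ).eventually_lt_const hδ0] with n hn hn1 hu0 hρδ e
  have hn' : (0 : ℝ) < n := by exact_mod_cast (by omega : 0 < n)
  have hL : 0 < log (n : ℝ) := log_pos (by exact_mod_cast hn1)
  have hρ0 : 0 ≤ γ / log n := by positivity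
  set a := √(2 * log (n : ℝ))
  have ha : 0 < a := sqrt_pos.2 (by positivity)
  set F : ℕ → ℝ := fun d => |r d - γ / log n| *
    rexp (-un n y ^ 2 / (1 + max |r d| (γ / log n)))
  have hu : un n x - un n y = (x - y) / a := by unfold un; ring
  have huxy : un n y ≤ un n x := by
    rw [← sub_nonneg, hu]
    exact div_nonneg (sub_nonneg.2 hxy) ha.le
  have hdist : ∀ i j : Fin n, i ≠ j → 1 ≤ Nat.dist i j := fun i j h => by
    refine Nat.dist_pos_of_ne fun h' => h (Fin.ext h')
  have hcmp := (hμ n).abs_countEvent_sub_le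
    (gaussCov_equiLaw (ι := Fin n) hρ0 (hρδ.le.trans hδ1.le))
    (fun i => by rw [Nat.dist_self, hr0]) (fun i => if_pos rfl) hC hC1 hC2
    (e := e) (K := K) (M := M) (δ := δ) (u₁ := un n x) (u₂ := un n y)
    (ω := fun i j => max |r (Nat.dist i j)| (γ / log n))
    (div_pos hs ha) huxy hu0 hδ1
    (fun i j h => max_le (hrδ _ (hdist i j h)) hρδ.le)
    (fun i j h => le_max_left _ _)
    (fun i j h => by rw [if_neg h, abs_of_nonneg hρ0]; exact le_max_right _ _)
  refine hcmp.trans ?_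
  have hterm : ∀ (i j : Fin n) (d₁ d₂ : Decidable (i = j)), (@ite _ _ d₁ 0
      (|(@ite _ (i = j) d₂ 1 (γ / log n)) - r (Nat.dist i j)| *
        (4 * C ^ 2 * (C / (s / a)) ^ 2 * (2 * (un n x - un n y + s / a) ^ 2 / (1 - δ) *
          rexp (-un n y ^ 2 / (1 + max |r (Nat.dist i j)| (γ / log n)))))) : ℝ) =
      D * (@ite _ _ (instDecidableEqFin n i j) 0 (F (Nat.dist i j))) := by
    intro i j d₁ d₂
    split_ifs with h
    · rw [mul_zero]
    · have h1 : (1 - δ) ≠ 0 := by linarith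
      rw [abs_sub_comm, hu]
      simp only [D, F]
      field_simp
  have hdouble : ∑ i : Fin n, ∑ j : Fin n, (if i = j then 0 else F (Nat.dist i j)) ≤
      2 * (n * ∑ d ∈ Finset.Ico 1 n, F d) := by
    calc _ ≤ ∑ i : Fin n, 2 * ∑ d ∈ Finset.Ico 1 n, F d :=
          Finset.sum_le_sum fun i _ => sum_dist_le (fun d => by positivity) i
      _ = _ := by
          rw [Finset.sum_const, Finset.card_univ, Fintype.card_fin, nsmul_eq_mul]; ring
  have hlast : 4 * (Fintype.card (Fin n) : ℝ) * (s / a * rexp (-un n y ^ 2 / 2)) ≤ θ / 2 := by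
    calc _ ≤ 4 * (n : ℝ) * (s / a * (c * (a / n))) := by
          rw [Fintype.card_fin]
          gcongr
          exact exp_neg_sq_un_le hn1 y
      _ = θ / 2 := by
          simp only [s]
          field_simp
          norm_num
  simp_rw [hterm, ← Finset.mul_sum]
  have hfar : 4 * D * (n * ∑ d ∈ Finset.Ico 1 n, F d) < θ / 2 := hn
  refine (add_le_add (mul_le_mul_of_nonneg_left (mul_le_mul_of_nonneg_left hdouble hD)
    zero_le_two) hlast).trans ?_
  linarith

section Reindex

lemma sum_Icc_one_eq_sum_fin {M : Type*} [AddCommMonoid M] (f : ℕ → M) (n : ℕ) :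
    ∑ k ∈ Finset.Icc 1 n, f k = ∑ i : Fin n, f (i + 1) := by
  induction n with
  | zero => simp
  | succ n ih =>
    rw [Finset.sum_Icc_succ_top (by omega), ih, Fin.sum_univ_castSucc]
    rfl

lemma card_filter_Icc_one (p : ℕ → Prop) [DecidablePred p] (n : ℕ) :
    ((Finset.Icc 1 n).filter p).card =
      ((Finset.univ : Finset (Fin n)).filter fun i : Fin n => p (i + 1)).card := by
  rw [Finset.card_filter, Finset.card_filter, sum_Icc_one_eq_sum_fin]

end Reindex

section PoissonTerm

lemma abs_poissonTerm_le {ℓ g₁ g₂ : ℝ} (h0 : 0 ≤ ℓ) (h1 : ℓ ≤ 1) (hg : 0 ≤ g₁) (hgg : g₁ ≤ g₂)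
    (t j l : ℕ) : |poissonTerm ℓ g₁ g₂ t j l| ≤ (Nat.factorial (t + j + l) : ℝ) := by
  have hg2 : 0 ≤ g₂ := hg.trans hgg
  have hpow : ∀ {a : ℝ}, 0 ≤ a → a ≤ g₂ → ∀ m : ℕ, a ^ m / (Nat.factorial m : ℝ) ≤ g₂ ^ m := by
    intro a ha hag m
    have : (1 : ℝ) ≤ (Nat.factorial m : ℝ) := by exact_mod_cast Nat.factorial_pos m
    calc a ^ m / (Nat.factorial m : ℝ) ≤ a ^ m := div_le_self (by positivity) this
      _ ≤ g₂ ^ m := by gcongr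
  have a1 : 0 ≤ (1 - ℓ) * g₂ := mul_nonneg (sub_nonneg.2 h1) hg2
  have a2 : 0 ≤ ℓ * g₁ := mul_nonneg h0 hg
  have a3 : 0 ≤ ℓ * (g₂ - g₁) := mul_nonneg h0 (sub_nonneg.2 hgg)
  have b1 := hpow a1 (by nlinarith) t
  have b2 := hpow a2 (by nlinarith) j
  have b3 := hpow a3 (by nlinarith) l
  rw [poissonTerm, abs_of_nonneg (by positivity)]
  have key := pow_div_factorial_le_exp g₂ hg2 (t + j + l)
  rw [div_le_iff₀ (by exact_mod_cast Nat.factorial_pos _)] at key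
  calc _ ≤ g₂ ^ t * rexp (-g₂) * (g₂ ^ j * g₂ ^ l) := by gcongr
    _ = g₂ ^ (t + j + l) * rexp (-g₂) := by rw [pow_add, pow_add]; ring
    _ ≤ rexp g₂ * (Nat.factorial (t + j + l) : ℝ) * rexp (-g₂) := by gcongr
    _ = (Nat.factorial (t + j + l) : ℝ) := by
      rw [mul_right_comm, ← exp_add, add_neg_cancel, exp_zero, one_mul]

lemma g_pos (γ x z : ℝ) : 0 < g γ x z := exp_pos _

lemma g_anti {γ x y : ℝ} (h : y ≤ x) (z : ℝ) : g γ x z ≤ g γ y z := by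
  unfold g
  gcongr

lemma measurable_poissonTerm (γ x y : ℝ) (t j l : ℕ) :
    Measurable fun p : ℝ × ℝ => poissonTerm p.1 (g γ x p.2) (g γ y p.2) t j l := by
  unfold poissonTerm g
  fun_prop

variable {γ x y : ℝ}

lemma integrable_poissonTerm (hxy : y ≤ x) {ℓ : ℝ} (hℓ : ℓ ∈ Set.Icc (0 : ℝ) 1) (t j l : ℕ) :
    Integrable (fun z => poissonTerm ℓ (g γ x z) (g γ y z) t j l) (gaussianReal 0 1) :=
  Integrable.of_bound
    ((measurable_poissonTerm γ x y t j l).comp (by fun_prop :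
      Measurable fun z : ℝ => (ℓ, z))).aestronglyMeasurable _
    (ae_of_all _ fun z => abs_poissonTerm_le hℓ.1 hℓ.2 (g_pos γ x z).le (g_anti hxy z) t j l)

variable {Ω : Type*} [MeasurableSpace Ω] {P : Measure Ω} [IsProbabilityMeasure P] {lam : Ω → ℝ}

lemma integrable_integral_poissonTerm (hxy : y ≤ x) (hlam : Measurable lam)
    (hlam01 : ∀ᵐ ω ∂P, lam ω ∈ Set.Icc (0 : ℝ) 1) (t j l : ℕ) :
    Integrable (fun ω => ∫ z, poissonTerm (lam ω) (g γ x z) (g γ y z) t j l ∂gaussianReal 0 1)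
      P := by
  have hm : Measurable fun p : Ω × ℝ => poissonTerm (lam p.1) (g γ x p.2) (g γ y p.2) t j l :=
    (measurable_poissonTerm γ x y t j l).comp ((hlam.comp measurable_fst).prodMk measurable_snd)
  refine Integrable.of_bound
    hm.stronglyMeasurable.integral_prod_right.aestronglyMeasurable
    (Nat.factorial (t + j + l) : ℝ) ?_
  filter_upwards [hlam01] with ω hω
  refine (norm_integral_le_of_norm_le_const (C := (Nat.factorial (t + j + l) : ℝ))
    (ae_of_all _ fun z =>
      abs_poissonTerm_le hω.1 hω.2 (g_pos γ x z).le (g_anti hxy z) t j l)).trans ?_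
  simp

lemma integral_condLimit (hxy : y ≤ x) (hlam : Measurable lam)
    (hlam01 : ∀ᵐ ω ∂P, lam ω ∈ Set.Icc (0 : ℝ) 1) (K M : ℕ) :
    ∫ ω, ∫ z, condLimit γ x y K M (lam ω) z ∂gaussianReal 0 1 ∂P =
      ∑ t ∈ Finset.range (M + 1), ∑ i ∈ Finset.range (M + 1 - t),
        ∑ j ∈ Finset.range (min i K + 1),
          ∫ ω, ∫ z, poissonTerm (lam ω) (g γ x z) (g γ y z) t j (i - j) ∂gaussianReal 0 1 ∂P := by
  have inner : ∀ᵐ ω ∂P, ∫ z, condLimit γ x y K M (lam ω) z ∂gaussianReal 0 1 =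
      ∑ t ∈ Finset.range (M + 1), ∑ i ∈ Finset.range (M + 1 - t),
        ∑ j ∈ Finset.range (min i K + 1),
          ∫ z, poissonTerm (lam ω) (g γ x z) (g γ y z) t j (i - j) ∂gaussianReal 0 1 := by
    filter_upwards [hlam01] with ω hω
    have hi := fun t j l => integrable_poissonTerm (γ := γ) hxy hω t j l
    unfold condLimit
    rw [integral_finsetSum _ fun t _ => integrable_finsetSum _ fun i _ =>
      integrable_finsetSum _ fun j _ => hi t j (i - j)]
    refine Finset.sum_congr rfl fun t _ => ?_
    rw [integral_finsetSum _ fun i _ => integrable_finsetSum _ fun j _ => hi t j (i - j)]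
    refine Finset.sum_congr rfl fun i _ => ?_
    rw [integral_finsetSum _ fun j _ => hi t j (i - j)]
  have hi := fun t j l => integrable_integral_poissonTerm (γ := γ) hxy hlam hlam01 t j l
  rw [integral_congr_ae inner, integral_finsetSum _ fun t _ => integrable_finsetSum _ fun i _ =>
    integrable_finsetSum _ fun j _ => hi t j (i - j)]
  refine Finset.sum_congr rfl fun t _ => ?_
  rw [integral_finsetSum _ fun i _ => integrable_finsetSum _ fun j _ => hi t j (i - j)]
  refine Finset.sum_congr rfl fun i _ => ?_
  rw [integral_finsetSum _ fun j _ => hi t j (i - j)]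

end PoissonTerm

section RandomMask

variable {Ω : Type*} [MeasurableSpace Ω] {P : Measure Ω} [IsProbabilityMeasure P]

lemma measure_countEvent_of_indepFun {n : ℕ} {f : Ω → Fin n → ℝ} {h : Ω → Fin n → Bool}
    (hf : Measurable f) (hh : Measurable h) (hfh : IndepFun f h P) (K M : ℕ) (u₁ u₂ : ℝ) :
    (P {ω | f ω ∈ countEvent (h ω) K M u₁ u₂}).toReal =
      ∫ ω, (P.map f (countEvent (h ω) K M u₁ u₂)).toReal ∂P := by
  set A : Set ((Fin n → ℝ) × (Fin n → Bool)) := {p | p.1 ∈ countEvent p.2 K M u₁ u₂}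
  have hA : MeasurableSet A := by
    have : A = ⋃ e : Fin n → Bool, countEvent e K M u₁ u₂ ×ˢ {e} := by
      ext p
      simp [A]
    rw [this]
    exact MeasurableSet.iUnion fun e => measurableSet_countEvent.prod (measurableSet_singleton e)
  have hmeas : Measurable fun e : Fin n → Bool => P.map f (countEvent e K M u₁ u₂) :=
    measurable_of_finite _
  have := Measure.isProbabilityMeasure_map (μ := P) hf.aemeasurable
  have := Measure.isProbabilityMeasure_map (μ := P) hh.aemeasurable
  have hP : P {ω | f ω ∈ countEvent (h ω) K M u₁ u₂} =
      ∫⁻ ω, P.map f (countEvent (h ω) K M u₁ u₂) ∂P := by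
    have h1 : P {ω | f ω ∈ countEvent (h ω) K M u₁ u₂} = P.map (fun ω => (f ω, h ω)) A := by
      rw [Measure.map_apply (hf.prodMk hh) hA]
      rfl
    rw [h1, (indepFun_iff_map_prod_eq_prod_map_map hf.aemeasurable hh.aemeasurable).1 hfh,
      Measure.prod_apply_symm hA, ← lintegral_map hmeas hh]
    rfl
  rw [hP]
  exact (integral_toReal (hmeas.comp hh).aemeasurable
    (ae_of_all _ fun _ => measure_lt_top _ _)).symm

end RandomMask

theorem stmt2
    {Ω : Type} [MeasurableSpace Ω] (P : Measure Ω) [IsProbabilityMeasure P]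
    (X : ℕ → Ω → ℝ) (ε : ℕ → Ω → Bool) (lam : Ω → ℝ) (γ : ℝ)
    (hγ : 0 ≤ γ)
    (hXmeas : ∀ n, Measurable (X n))
    (hεmeas : ∀ n, Measurable (ε n))
    (hlam : Measurable lam)
    -- every finite-dimensional distribution of `X` is centered Gaussian
    (hGauss : ∀ (m : ℕ) (idx : Fin m → ℕ) (c : Fin m → ℝ), ∃ v : ℝ≥0,
      Measure.map (fun ω => ∑ i, c i * X (idx i) ω) P = gaussianReal 0 v)
    -- each `X n` is standard Gaussian
    (hstd : ∀ n, Measure.map (X n) P = gaussianReal 0 1)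
    -- stationarity
    (hstat : ∀ (m k : ℕ),
      Measure.map (fun ω => fun i : Fin m => X (i.1 + 1 + k) ω) P =
        Measure.map (fun ω => fun i : Fin m => X (i.1 + 1) ω) P)
    -- `r_n ln n → γ`
    (hr : Tendsto (fun n : ℕ => (∫ ω, X 1 ω * X (n + 1) ω ∂P) * Real.log n)
      atTop (nhds γ))
    -- independence of the sequences `X` and `ε`
    (hindep : IndepFun (fun ω => fun n => X n ω) (fun ω => fun n => ε n ω) P)
    (hlam01 : ∀ᵐ ω ∂P, lam ω ∈ Set.Icc (0 : ℝ) 1)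
    -- `S_n / n → λ` in probability
    (hS : TendstoInMeasure P
      (fun n ω => (∑ k ∈ Finset.Icc 1 n, (if ε k ω then (1 : ℝ) else 0)) / n)
      atTop lam)
    (k m : ℕ) (hk : 1 ≤ k) (hm : 1 ≤ m) (x y : ℝ) (hxy : y ≤ x) :
    Tendsto (fun n : ℕ =>
      (P {ω | ((Finset.Icc 1 n).filter
            (fun j => un n x < X j ω ∧ ε j ω = true)).card ≤ k - 1 ∧
          ((Finset.Icc 1 n).filter (fun j => un n y < X j ω)).card ≤ m - 1}).toReal)
      atTop
      (nhds (∑ t ∈ Finset.range m, ∑ i ∈ Finset.range (m - t),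
          ∑ j ∈ Finset.range (min i (k - 1) + 1),
        ∫ ω, ∫ z,
          ((1 - lam ω) * g γ y z) ^ t / (Nat.factorial t : ℝ) *
            Real.exp (-(g γ y z)) *
          ((lam ω * g γ x z) ^ j / (Nat.factorial j : ℝ) *
            ((lam ω * (g γ y z - g γ x z)) ^ (i - j) / (Nat.factorial (i - j) : ℝ)))
          ∂(gaussianReal 0 1) ∂P)) := by
  obtain ⟨K, rfl⟩ : ∃ K, k = K + 1 := ⟨k - 1, by omega⟩
  obtain ⟨M, rfl⟩ : ∃ M, m = M + 1 := ⟨m - 1, by omega⟩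
  simp only [Nat.add_sub_cancel]
  change Tendsto _ _ (nhds (∑ t ∈ Finset.range (M + 1), ∑ i ∈ Finset.range (M + 1 - t),
    ∑ j ∈ Finset.range (min i K + 1), ∫ ω, ∫ z,
      poissonTerm (lam ω) (g γ x z) (g γ y z) t j (i - j) ∂gaussianReal 0 1 ∂P))
  rw [← integral_condLimit hxy hlam hlam01]
  set r : ℕ → ℝ := fun d => ∫ ω, X 1 ω * X (d + 1) ω ∂P
  have hsq : ∀ n, ∫ ω, X n ω ^ 2 ∂P = 1 := fun n => by
    simpa using integral_sq_of_map_eq_gaussianReal (hXmeas n) (hstd n)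
  have hr0 : r 0 = 1 := by
    simp only [r, zero_add, ← sq, hsq]
  have hrlim : Tendsto r atTop (nhds 0) := by
    have := hr.mul (tendsto_inv_atTop_zero.comp tendsto_log_natCast)
    rw [mul_zero] at this
    refine this.congr' ?_
    filter_upwards [eventually_gt_atTop 1] with n hn
    have : log (n : ℝ) ≠ 0 := (log_pos (by exact_mod_cast hn)).ne'
    simp only [Function.comp_apply]
    rw [mul_assoc, mul_inv_cancel₀ this, mul_one]
  obtain ⟨δ, hδ0, hδ1, hrδ⟩ := exists_bound_lt_one hrlim fun d hd =>
    abs_covariance_lt_one (fun n => memLp_two_of_map_eq_gaussianReal (hXmeas n) (hstd n)) hsq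
      (integral_mul_add_of_stationary hXmeas hstat) hrlim hd
  set f : ∀ n : ℕ, Ω → Fin n → ℝ := fun n ω i => X (i + 1) ω
  set h : ∀ n : ℕ, Ω → Fin n → Bool := fun n ω i => ε (i + 1) ω
  have hf : ∀ n, Measurable (f n) := fun n => by fun_prop
  have hh : ∀ n, Measurable (h n) := fun n => by fun_prop
  have hprob : ∀ n, IsProbabilityMeasure (P.map (f n)) := fun n =>
    Measure.isProbabilityMeasure_map (hf n).aemeasurable
  have hcov : ∀ n, GaussCov (P.map (f n)) fun i j => r (Nat.dist i j) := by
    intro n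
    have hrS : (fun i j : Fin n => r (Nat.dist i j)) =
        fun i j : Fin n => ∫ ω, X (i + 1) ω * X (j + 1) ω ∂P := by
      ext i j
      exact (integral_mul_eq_of_stationary hXmeas hstat i j).symm
    rw [hrS]
    exact gaussCov_map (P := P) (Y := fun (i : Fin n) ω => X (i + 1) ω) (fun i => hXmeas _)
      fun c => hGauss n (fun i => i + 1) c
  have hcount : ∀ n ω, ((Finset.univ.filter fun i => h n ω i = true).card : ℝ) =
      ∑ k ∈ Finset.Icc 1 n, (if ε k ω then (1 : ℝ) else 0) := by
    intro n ω
    rw [sum_Icc_one_eq_sum_fin, Finset.card_filter]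
    push_cast
    rfl
  have hevent : ∀ n : ℕ, (P {ω | ((Finset.Icc 1 n).filter
      (fun j => un n x < X j ω ∧ ε j ω = true)).card ≤ K ∧
      ((Finset.Icc 1 n).filter (fun j => un n y < X j ω)).card ≤ M}).toReal =
      ∫ ω, (P.map (f n) (countEvent (h n ω) K M (un n x) (un n y))).toReal ∂P := by
    intro n
    have hind : IndepFun (f n) (h n) P :=
      hindep.comp (φ := fun (v : ℕ → ℝ) (i : Fin n) => v (i + 1))
        (ψ := fun (v : ℕ → Bool) (i : Fin n) => v (i + 1)) (by fun_prop) (by fun_prop)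
    rw [← measure_countEvent_of_indepFun (hf n) (hh n) hind]
    simp only [card_filter_Icc_one]
    congr 3
  simp_rw [hevent]
  refine tendsto_of_subseq_tendsto fun ns hns => ?_
  obtain ⟨ms, hms, hae⟩ := TendstoInMeasure.exists_seq_tendsto_ae
    (f := fun k ω => (∑ j ∈ Finset.Icc 1 (ns k), (if ε j ω then (1 : ℝ) else 0)) / (ns k))
    (fun θ hθ => (hS θ hθ).comp hns)
  refine ⟨ms, ?_⟩
  have hsub : map (fun k => ns (ms k)) atTop ≤ atTop := hns.comp hms.tendsto_atTop
  refine tendsto_integral_of_dominated_convergence (fun _ => 1) (fun k => ?_)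
    (integrable_const _) (fun k => ae_of_all _ fun ω => ?_) ?_
  · exact ((measurable_of_finite fun e : Fin (ns (ms k)) → Bool =>
      (P.map (f (ns (ms k))) (countEvent e K M (un (ns (ms k)) x)
        (un (ns (ms k)) y))).toReal).comp (hh _)).aestronglyMeasurable
  · rw [norm_of_nonneg ENNReal.toReal_nonneg]
    exact measureReal_le_one
  · filter_upwards [hae] with ω hω
    have hmask : Tendsto (fun n => ((Finset.univ.filter fun i => h n ω i = true).card : ℝ) / n)
        (map (fun k => ns (ms k)) atTop) (nhds (lam ω)) := by
      simp_rw [hcount]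
      exact tendsto_map'_iff.2 hω
    have hequi := tendsto_equiLaw_countEvent (γ := γ) hxy K M hsub (e := fun n => h n ω) hmask
    have hdiff : Tendsto (fun n => (P.map (f n)
        (countEvent (h n ω) K M (un n x) (un n y))).toReal -
        (equiLaw (Fin n) (γ / log n) (countEvent (h n ω) K M (un n x) (un n y))).toReal) atTop
        (nhds 0) := by
      rw [Metric.tendsto_atTop']
      intro θ hθ
      obtain ⟨N, hN⟩ := eventually_atTop.1 (eventually_abs_countEvent_sub_equiLaw_le hcov hγ hr0 hr
        hδ0 hδ1 hrδ hxy K M (half_pos hθ))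
      refine ⟨N, fun n hn => ?_⟩
      rw [Real.dist_eq, sub_zero, abs_sub_comm]
      linarith [hN n hn.le (h n ω)]
    have := hequi.add (hdiff.mono_left hsub)
    simp only [add_sub_cancel, add_zero] at this
    exact tendsto_map'_iff.1 this
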